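/- arXiv:1411.4611 — 5 statements merged into one kernel-verified Lean document; each statement's English description precedes it below -/
import Mathlib

section
/- Let W be a multiplicative unitary on a complex Hilbert space H. Then Â(W) is a norm-closed subalgebra of B(H) (it is closed under operator composition), and it acts non-degenerately on H: the linear span of {a ζ : a ∈ Â(W), ζ ∈ H} is dense in H. -/
/-!
Common framework: we axiomatize realizations of Hilbert-space tensor products.
A `TensorPair E F EF` realizes the Hilbert tensor product `E ⊗ F` as the Hilbert
space `EF`: it consists of a bilinear map `(a, b) ↦ a ⊗ b` whose image satisfies
the characteristic inner-product identity and has total (dense) linear span.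
Operators such as the leg operators `X₁₂`, `X₂₃`, `X₁₃`, amplifications `a ⊗ b`,
and the tensor flip `Σ` are then uniquely characterized by their matrix
coefficients against elementary tensors.
-/

noncomputable section

open scoped InnerProductSpace
open ContinuousLinearMap

/-- A realization of the Hilbert tensor product `E ⊗ F` as the Hilbert space `EF`. -/
structure TensorPair (E F EF : Type*)
    [NormedAddCommGroup E] [InnerProductSpace ℂ E]
    [NormedAddCommGroup F] [InnerProductSpace ℂ F]
    [NormedAddCommGroup EF] [InnerProductSpace ℂ EF] where
  tmul : E →ₗ[ℂ] F →ₗ[ℂ] EF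
  inner_tmul : ∀ (a c : E) (b d : F), ⟪tmul a b, tmul c d⟫_ℂ = ⟪a, c⟫_ℂ * ⟪b, d⟫_ℂ
  dense_span : Dense (Submodule.span ℂ {z : EF | ∃ a b, z = tmul a b} : Set EF)

/-- A realization of the threefold Hilbert tensor product `E ⊗ F ⊗ G` as `EFG`. -/
structure TensorTriple (E F G EFG : Type*)
    [NormedAddCommGroup E] [InnerProductSpace ℂ E]
    [NormedAddCommGroup F] [InnerProductSpace ℂ F]
    [NormedAddCommGroup G] [InnerProductSpace ℂ G]
    [NormedAddCommGroup EFG] [InnerProductSpace ℂ EFG] where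
  tmul : E →ₗ[ℂ] F →ₗ[ℂ] G →ₗ[ℂ] EFG
  inner_tmul : ∀ (a a' : E) (b b' : F) (c c' : G),
    ⟪tmul a b c, tmul a' b' c'⟫_ℂ = ⟪a, a'⟫_ℂ * ⟪b, b'⟫_ℂ * ⟪c, c'⟫_ℂ
  dense_span : Dense (Submodule.span ℂ {z : EFG | ∃ a b c, z = tmul a b c} : Set EFG)

/-- The norm-closed linear span `[S]` of a set of vectors/operators. -/
def cspan {V : Type*} [NormedAddCommGroup V] [NormedSpace ℂ V] (S : Set V) : Set V :=
  closure (Submodule.span ℂ S : Set V)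

/-- The set of right-leg slices `(id ⊗ ω_{ξ,η})(X)` of an operator
`X : M₁ ⊗ K₁ → M₂ ⊗ K₂`, i.e. all operators `T : M₁ → M₂` such that
`⟪ζ, T ζ'⟫ = ⟪ζ ⊗ ξ, X (ζ' ⊗ η)⟫` for some `ξ ∈ K₂`, `η ∈ K₁`. -/
def slicesR {M₁ K₁ M₂ K₂ Ha Hb : Type*}
    [NormedAddCommGroup M₁] [InnerProductSpace ℂ M₁]
    [NormedAddCommGroup K₁] [InnerProductSpace ℂ K₁]
    [NormedAddCommGroup M₂] [InnerProductSpace ℂ M₂]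
    [NormedAddCommGroup K₂] [InnerProductSpace ℂ K₂]
    [NormedAddCommGroup Ha] [InnerProductSpace ℂ Ha]
    [NormedAddCommGroup Hb] [InnerProductSpace ℂ Hb]
    (ta : TensorPair M₁ K₁ Ha) (tb : TensorPair M₂ K₂ Hb)
    (X : Ha →L[ℂ] Hb) : Set (M₁ →L[ℂ] M₂) :=
  {T | ∃ (ξ : K₂) (η : K₁), ∀ (ζ : M₂) (ζ' : M₁),
    ⟪ζ, T ζ'⟫_ℂ = ⟪tb.tmul ζ ξ, X (ta.tmul ζ' η)⟫_ℂ}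

/-- The set of left-leg slices `(ω_{ξ,η} ⊗ id)(X)` of an operator
`X : K₁ ⊗ M₁ → K₂ ⊗ M₂`, i.e. all operators `T : M₁ → M₂` such that
`⟪ζ, T ζ'⟫ = ⟪ξ ⊗ ζ, X (η ⊗ ζ')⟫` for some `ξ ∈ K₂`, `η ∈ K₁`. -/
def slicesL {M₁ K₁ M₂ K₂ Ha Hb : Type*}
    [NormedAddCommGroup M₁] [InnerProductSpace ℂ M₁]
    [NormedAddCommGroup K₁] [InnerProductSpace ℂ K₁]
    [NormedAddCommGroup M₂] [InnerProductSpace ℂ M₂]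
    [NormedAddCommGroup K₂] [InnerProductSpace ℂ K₂]
    [NormedAddCommGroup Ha] [InnerProductSpace ℂ Ha]
    [NormedAddCommGroup Hb] [InnerProductSpace ℂ Hb]
    (ta : TensorPair K₁ M₁ Ha) (tb : TensorPair K₂ M₂ Hb)
    (X : Ha →L[ℂ] Hb) : Set (M₁ →L[ℂ] M₂) :=
  {T | ∃ (ξ : K₂) (η : K₁), ∀ (ζ : M₂) (ζ' : M₁),
    ⟪ζ, T ζ'⟫_ℂ = ⟪tb.tmul ξ ζ, X (ta.tmul η ζ')⟫_ℂ}

/-- `Â(X) := [(id ⊗ ω_{ξ,η})(X) : ξ, η ∈ H] ⊆ B(H)` for `X ∈ B(H ⊗ H)`. -/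
def hatA {H H2 : Type*}
    [NormedAddCommGroup H] [InnerProductSpace ℂ H]
    [NormedAddCommGroup H2] [InnerProductSpace ℂ H2]
    (t2 : TensorPair H H H2) (X : H2 →L[ℂ] H2) : Set (H →L[ℂ] H) :=
  cspan (slicesR t2 t2 X)

/-- `A(X) := [(ω_{ξ,η} ⊗ id)(X) : ξ, η ∈ H] ⊆ B(H)` for `X ∈ B(H ⊗ H)`. -/
def legA {H H2 : Type*}
    [NormedAddCommGroup H] [InnerProductSpace ℂ H]
    [NormedAddCommGroup H2] [InnerProductSpace ℂ H2]
    (t2 : TensorPair H H H2) (X : H2 →L[ℂ] H2) : Set (H →L[ℂ] H) :=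
  cspan (slicesL t2 t2 X)

/-- `T` is the tensor-product operator `a ⊗ b : E ⊗ F → E' ⊗ F'`, characterized by its
matrix coefficients against elementary tensors.  In particular `IsTensorOp ta tb a 1 T`
says that `T = a ⊗ 1`, and `IsTensorOp ta tb 1 b T` that `T = 1 ⊗ b`. -/
def IsTensorOp {E F EF E' F' EF' : Type*}
    [NormedAddCommGroup E] [InnerProductSpace ℂ E]
    [NormedAddCommGroup F] [InnerProductSpace ℂ F]
    [NormedAddCommGroup EF] [InnerProductSpace ℂ EF]
    [NormedAddCommGroup E'] [InnerProductSpace ℂ E']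
    [NormedAddCommGroup F'] [InnerProductSpace ℂ F']
    [NormedAddCommGroup EF'] [InnerProductSpace ℂ EF']
    (ta : TensorPair E F EF) (tb : TensorPair E' F' EF')
    (a : E →L[ℂ] E') (b : F →L[ℂ] F') (T : EF →L[ℂ] EF') : Prop :=
  ∀ (ζ : E') (ξ : F') (ζ' : E) (η : F),
    ⟪tb.tmul ζ ξ, T (ta.tmul ζ' η)⟫_ℂ = ⟪ζ, a ζ'⟫_ℂ * ⟪ξ, b η⟫_ℂ

/-- `A ⊗min B := [(a ⊗ 1)(1 ⊗ b) : a ∈ A, b ∈ B] = [a ⊗ b : a ∈ A, b ∈ B]`. -/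
def minTensor {E F EF : Type*}
    [NormedAddCommGroup E] [InnerProductSpace ℂ E]
    [NormedAddCommGroup F] [InnerProductSpace ℂ F]
    [NormedAddCommGroup EF] [InnerProductSpace ℂ EF]
    (t : TensorPair E F EF)
    (A : Set (E →L[ℂ] E)) (B : Set (F →L[ℂ] F)) : Set (EF →L[ℂ] EF) :=
  cspan {T | ∃ a ∈ A, ∃ b ∈ B, IsTensorOp t t a b T}

/-- `Y = X₁₂ = X ⊗ 1` on `E ⊗ F ⊗ G`, for `X ∈ B(E ⊗ F)`. -/
def IsLeg12 {E F G EF EFG : Type*}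
    [NormedAddCommGroup E] [InnerProductSpace ℂ E]
    [NormedAddCommGroup F] [InnerProductSpace ℂ F]
    [NormedAddCommGroup G] [InnerProductSpace ℂ G]
    [NormedAddCommGroup EF] [InnerProductSpace ℂ EF]
    [NormedAddCommGroup EFG] [InnerProductSpace ℂ EFG]
    (t2 : TensorPair E F EF) (t3 : TensorTriple E F G EFG)
    (X : EF →L[ℂ] EF) (Y : EFG →L[ℂ] EFG) : Prop :=
  ∀ (a a' : E) (b b' : F) (c c' : G),
    ⟪t3.tmul a b c, Y (t3.tmul a' b' c')⟫_ℂ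
      = ⟪t2.tmul a b, X (t2.tmul a' b')⟫_ℂ * ⟪c, c'⟫_ℂ

/-- `Y = X₂₃ = 1 ⊗ X` on `E ⊗ F ⊗ G`, for `X ∈ B(F ⊗ G)`. -/
def IsLeg23 {E F G FG EFG : Type*}
    [NormedAddCommGroup E] [InnerProductSpace ℂ E]
    [NormedAddCommGroup F] [InnerProductSpace ℂ F]
    [NormedAddCommGroup G] [InnerProductSpace ℂ G]
    [NormedAddCommGroup FG] [InnerProductSpace ℂ FG]
    [NormedAddCommGroup EFG] [InnerProductSpace ℂ EFG]
    (t2 : TensorPair F G FG) (t3 : TensorTriple E F G EFG)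
    (X : FG →L[ℂ] FG) (Y : EFG →L[ℂ] EFG) : Prop :=
  ∀ (a a' : E) (b b' : F) (c c' : G),
    ⟪t3.tmul a b c, Y (t3.tmul a' b' c')⟫_ℂ
      = ⟪t2.tmul b c, X (t2.tmul b' c')⟫_ℂ * ⟪a, a'⟫_ℂ

/-- `Y = X₁₃ = Σ₁₂X₂₃Σ₁₂` on `E ⊗ F ⊗ G`, for `X ∈ B(E ⊗ G)`: `X` acting on the
first and third legs. -/
def IsLeg13 {E F G EG EFG : Type*}
    [NormedAddCommGroup E] [InnerProductSpace ℂ E]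
    [NormedAddCommGroup F] [InnerProductSpace ℂ F]
    [NormedAddCommGroup G] [InnerProductSpace ℂ G]
    [NormedAddCommGroup EG] [InnerProductSpace ℂ EG]
    [NormedAddCommGroup EFG] [InnerProductSpace ℂ EFG]
    (t2 : TensorPair E G EG) (t3 : TensorTriple E F G EFG)
    (X : EG →L[ℂ] EG) (Y : EFG →L[ℂ] EFG) : Prop :=
  ∀ (a a' : E) (b b' : F) (c c' : G),
    ⟪t3.tmul a b c, Y (t3.tmul a' b' c')⟫_ℂ
      = ⟪t2.tmul a c, X (t2.tmul a' c')⟫_ℂ * ⟪b, b'⟫_ℂ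

section Helpers

variable {H H2 H3 : Type*}
    [NormedAddCommGroup H] [InnerProductSpace ℂ H]
    [NormedAddCommGroup H2] [InnerProductSpace ℂ H2]
    [NormedAddCommGroup H3] [InnerProductSpace ℂ H3]

lemma closed_span_induction {V : Type*} [NormedAddCommGroup V] [NormedSpace ℂ V] {S : Set V}
    {p : V → Prop} (hc : IsClosed {x | p x}) (hS : ∀ x ∈ S, p x) (h0 : p 0)
    (ha : ∀ x y, p x → p y → p (x + y)) (hs : ∀ (c : ℂ) x, p x → p (c • x))
    {x : V} (hx : x ∈ closure (Submodule.span ℂ S : Set V)) : p x := by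
  have hsub : (Submodule.span ℂ S : Set V) ⊆ {x | p x} := by
    intro y hy
    exact Submodule.span_induction (p := fun y _ => p y) hS h0
      (fun x y _ _ => ha x y) (fun c x _ => hs c x) hy
  exact closure_minimal hsub hc hx

lemma TensorPair.induct (t2 : TensorPair H H H2) {p : H2 → Prop} (hc : IsClosed {x | p x})
    (hS : ∀ a b, p (t2.tmul a b))
    (ha : ∀ x y, p x → p y → p (x + y)) (hs : ∀ (c : ℂ) x, p x → p (c • x)) (x : H2) : p x := by
  refine closed_span_induction hc (S := {z : H2 | ∃ a b, z = t2.tmul a b}) ?_ ?_ ha hs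
    (t2.dense_span x)
  · rintro _ ⟨a, b, rfl⟩; exact hS a b
  · simpa using hS 0 0

lemma TensorPair.ext_left (t2 : TensorPair H H H2) {x y : H2}
    (h : ∀ a b, ⟪t2.tmul a b, x⟫_ℂ = ⟪t2.tmul a b, y⟫_ℂ) : x = y := by
  refine ext_inner_left ℂ fun v => ?_
  refine t2.induct (p := fun v => ⟪v, x⟫_ℂ = ⟪v, y⟫_ℂ) ?_ h ?_ ?_ v
  · exact isClosed_eq (by fun_prop) (by fun_prop)
  · intro a b h1 h2; simp only [inner_add_left, h1, h2]
  · intro c a h1; simp only [inner_smul_left, h1]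

lemma TensorTriple.ext_left (t3 : TensorTriple H H H H3) {x y : H3}
    (h : ∀ a b c, ⟪t3.tmul a b c, x⟫_ℂ = ⟪t3.tmul a b c, y⟫_ℂ) : x = y := by
  refine ext_inner_left ℂ fun v => ?_
  refine closed_span_induction (p := fun v => ⟪v, x⟫_ℂ = ⟪v, y⟫_ℂ) ?_ ?_ ?_ ?_ ?_
    (t3.dense_span v)
  · exact isClosed_eq (by fun_prop) (by fun_prop)
  · rintro _ ⟨a, b, c, rfl⟩; exact h a b c
  · simp
  · intro a b h1 h2; simp only [inner_add_left, h1, h2]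
  · intro c a h1; simp only [inner_smul_left, h1]

lemma TensorPair.norm_tmul (t2 : TensorPair H H H2) (a b : H) :
    ‖t2.tmul a b‖ = ‖a‖ * ‖b‖ := by
  have h := t2.inner_tmul a a b b
  simp only [inner_self_eq_norm_sq_to_K] at h
  have h' : ‖t2.tmul a b‖ ^ 2 = (‖a‖ * ‖b‖) ^ 2 := by
    rw [mul_pow]; exact_mod_cast h
  exact (pow_left_inj₀ (norm_nonneg _) (by positivity) two_ne_zero).1 h'

open scoped TensorProduct in
lemma norm_lift_eq {K : Type*} [NormedAddCommGroup K] [InnerProductSpace ℂ K]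
    (B : H →ₗ[ℂ] H →ₗ[ℂ] K) (k : ℝ)
    (hB : ∀ a b a' b', ⟪B a b, B a' b'⟫_ℂ = (k : ℂ) ^ 2 * (⟪a, a'⟫_ℂ * ⟪b, b'⟫_ℂ))
    (x : H ⊗[ℂ] H) : ‖TensorProduct.lift B x‖ = |k| * ‖x‖ := by
  have h : ∀ x y : H ⊗[ℂ] H, ⟪TensorProduct.lift B x, TensorProduct.lift B y⟫_ℂ
      = (k : ℂ) ^ 2 * ⟪x, y⟫_ℂ := by
    intro x y
    induction x using TensorProduct.induction_on with
    | zero => simp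
    | add x x' h1 h2 => simp only [map_add, inner_add_left, h1, h2, mul_add]
    | tmul a b =>
      induction y using TensorProduct.induction_on with
      | zero => simp
      | add x x' h1 h2 => simp only [map_add, inner_add_right, h1, h2, mul_add]
      | tmul a' b' => simp [hB]
  have h := h x x
  have hx : ⟪x, x⟫_ℂ = (‖x‖ : ℂ) ^ 2 := inner_self_eq_norm_sq_to_K x
  rw [hx, inner_self_eq_norm_sq_to_K] at h
  have h' : ‖TensorProduct.lift B x‖ ^ 2 = (|k| * ‖x‖) ^ 2 := by
    rw [mul_pow, sq_abs]
    apply Complex.ofReal_injective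
    push_cast
    exact h
  exact (pow_left_inj₀ (norm_nonneg _) (by positivity) two_ne_zero).1 h'

open scoped TensorProduct in
/-- Extension of bilinear maps to the Hilbert tensor product. -/
lemma TensorPair.exists_extend [CompleteSpace H3] (t2 : TensorPair H H H2)
    (B : H →ₗ[ℂ] H →ₗ[ℂ] H3) (k : ℝ)
    (hB : ∀ a b a' b', ⟪B a b, B a' b'⟫_ℂ = (k : ℂ) ^ 2 * (⟪a, a'⟫_ℂ * ⟪b, b'⟫_ℂ)) :
    ∃ T : H2 →L[ℂ] H3, ∀ a b, T (t2.tmul a b) = B a b := by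
  have e1 : ∀ x, ‖TensorProduct.lift t2.tmul x‖ = ‖x‖ := by
    intro x
    have := norm_lift_eq t2.tmul 1 (by simp [t2.inner_tmul]) x
    simpa using this
  let e : H ⊗[ℂ] H →ₗᵢ[ℂ] H2 := ⟨TensorProduct.lift t2.tmul, e1⟩
  let f : H ⊗[ℂ] H →L[ℂ] H3 := (TensorProduct.lift B).mkContinuous |k|
    (fun x => (norm_lift_eq B k hB x).le)
  have hd : DenseRange e.toContinuousLinearMap := by
    refine t2.dense_span.mono ?_
    have : Submodule.span ℂ {z : H2 | ∃ a b, z = t2.tmul a b}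
        ≤ LinearMap.range (TensorProduct.lift t2.tmul) := by
      rw [Submodule.span_le]
      rintro _ ⟨a, b, rfl⟩
      exact ⟨a ⊗ₜ b, by simp⟩
    intro z hz
    exact this hz
  refine ⟨f.extend e.toContinuousLinearMap, fun a b => ?_⟩
  have := f.extend_eq hd e.isometry.isUniformInducing (a ⊗ₜ b)
  simpa [e, f] using this

lemma exists_slice [CompleteSpace H] [CompleteSpace H2] (t2 : TensorPair H H H2)
    (W : H2 →L[ℂ] H2) (ξ η : H) :
    ∃ T : H →L[ℂ] H, ∀ ζ ζ', ⟪ζ, T ζ'⟫_ℂ = ⟪t2.tmul ζ ξ, W (t2.tmul ζ' η)⟫_ℂ := by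
  have hR : ∀ ξ : H, ∃ R : H →L[ℂ] H2, ∀ ζ, R ζ = t2.tmul ζ ξ := fun ξ =>
    ⟨(t2.tmul.flip ξ).mkContinuous ‖ξ‖ (fun ζ => by
      simp [t2.norm_tmul, mul_comm]), fun ζ => by simp⟩
  obtain ⟨R, hR1⟩ := hR ξ
  obtain ⟨R', hR2⟩ := hR η
  refine ⟨adjoint R ∘L W ∘L R', fun ζ ζ' => ?_⟩
  simp [adjoint_inner_right, hR1, hR2]

/-- The amplification `u ↦ (ζ ↦ ζ ⊗ u)`. -/
lemma exists_amp [CompleteSpace H3] (t2 : TensorPair H H H2) (t3 : TensorTriple H H H H3) :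
    ∃ M : H2 →L[ℂ] H →L[ℂ] H3, (∀ a b ζ, M (t2.tmul a b) ζ = t3.tmul ζ a b) := by
  have hL : ∀ ζ : H, ∃ T : H2 →L[ℂ] H3, ∀ a b, T (t2.tmul a b) = t3.tmul ζ a b := fun ζ =>
    t2.exists_extend (t3.tmul ζ) ‖ζ‖ (by
      intro a b a' b'
      rw [t3.inner_tmul, inner_self_eq_norm_sq_to_K, mul_assoc]; rfl)
  choose L hL using hL
  have hin : ∀ ζ u, ‖L ζ u‖ ^ 2 = ‖ζ‖ ^ 2 * ‖u‖ ^ 2 := by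
    intro ζ u
    have : ∀ u v, ⟪L ζ u, L ζ v⟫_ℂ = ⟪ζ, ζ⟫_ℂ * ⟪u, v⟫_ℂ := by
      intro u v
      refine t2.induct (p := fun u => ⟪L ζ u, L ζ v⟫_ℂ = ⟪ζ, ζ⟫_ℂ * ⟪u, v⟫_ℂ) ?_ ?_ ?_ ?_ u
      · exact isClosed_eq (by fun_prop) (by fun_prop)
      · intro a b
        refine t2.induct (p := fun v => ⟪L ζ (t2.tmul a b), L ζ v⟫_ℂ
          = ⟪ζ, ζ⟫_ℂ * ⟪t2.tmul a b, v⟫_ℂ) ?_ ?_ ?_ ?_ v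
        · exact isClosed_eq (by fun_prop) (by fun_prop)
        · intro a' b'; rw [hL, hL, t3.inner_tmul, t2.inner_tmul, mul_assoc]
        · intro x y h1 h2; simp only [map_add, inner_add_right, h1, h2, mul_add]
        · intro c x h1; simp only [map_smul, inner_smul_right, h1]; ring
      · intro x y h1 h2; simp only [map_add, inner_add_left, h1, h2, mul_add]
      · intro c x h1; simp only [map_smul, inner_smul_left, h1]; ring
    have h := this u u
    simp only [inner_self_eq_norm_sq_to_K] at h
    exact_mod_cast h
  have hadd : ∀ ζ ζ' u, L (ζ + ζ') u = L ζ u + L ζ' u := by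
    intro ζ ζ' u
    refine t2.induct (p := fun u => L (ζ + ζ') u = L ζ u + L ζ' u) ?_ ?_ ?_ ?_ u
    · exact isClosed_eq (by fun_prop) (by fun_prop)
    · intro a b; simp [hL]
    · intro x y h1 h2; simp only [map_add, h1, h2]; abel
    · intro c x h1; simp only [map_smul, h1, smul_add]
  have hsmul : ∀ (c : ℂ) ζ u, L (c • ζ) u = c • L ζ u := by
    intro c ζ u
    refine t2.induct (p := fun u => L (c • ζ) u = c • L ζ u) ?_ ?_ ?_ ?_ u
    · exact isClosed_eq (by fun_prop) (by fun_prop)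
    · intro a b; simp [hL]
    · intro x y h1 h2; simp only [map_add, h1, h2, smul_add]
    · intro d x h1; simp only [map_smul, h1, smul_comm c d]
  refine ⟨LinearMap.mkContinuous₂ (LinearMap.mk₂ ℂ (fun u ζ => L ζ u) ?_ ?_ ?_ ?_) 1 ?_, ?_⟩
  · intro u v ζ; simp
  · intro c u ζ; simp
  · intro u ζ ζ'; exact hadd ζ ζ' u
  · intro c u ζ; exact hsmul c ζ u
  · intro u ζ
    simp only [LinearMap.mk₂_apply, one_mul]
    refine le_of_eq ((pow_left_inj₀ (norm_nonneg _) (by positivity) two_ne_zero).1 ?_)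
    rw [hin, mul_pow, mul_comm]
  · intro a b ζ
    simp [hL]

lemma exists_ampR [CompleteSpace H3] (t2 : TensorPair H H H2) (t3 : TensorTriple H H H H3)
    (c : H) : ∃ R : H2 →L[ℂ] H3, ∀ a b, R (t2.tmul a b) = t3.tmul a b c := by
  obtain ⟨R, hR⟩ := t2.exists_extend
    (LinearMap.mk₂ ℂ (fun a b => t3.tmul a b c) (by simp) (by simp) (by simp) (by simp)) ‖c‖ (by
      intro a b a' b'
      simp only [LinearMap.mk₂_apply]
      rw [t3.inner_tmul, inner_self_eq_norm_sq_to_K, mul_comm]; rfl)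
  exact ⟨R, fun a b => by simp [hR]⟩

lemma slice_mul [CompleteSpace H] [CompleteSpace H2] [CompleteSpace H3]
    (t2 : TensorPair H H H2) (t3 : TensorTriple H H H H3)
    (W : H2 →L[ℂ] H2) (hWu : star W * W = 1 ∧ W * star W = 1)
    (W12 W23 W13 : H3 →L[ℂ] H3)
    (hW12 : IsLeg12 t2 t3 W W12) (hW23 : IsLeg23 t2 t3 W W23)
    (hW13 : IsLeg13 t2 t3 W W13)
    (hpent : W23 * W12 = W12 * W13 * W23)
    (a b : H →L[ℂ] H) (ha : a ∈ slicesR t2 t2 W) (hb : b ∈ slicesR t2 t2 W) :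
    a * b ∈ hatA t2 W := by
  obtain ⟨ξ, η, ha⟩ := ha
  obtain ⟨ξ', η', hb⟩ := hb
  obtain ⟨M, hM⟩ := exists_amp t2 t3
  obtain ⟨R, hR⟩ := exists_ampR t2 t3 ξ'
  have hWW : ∀ x, W (adjoint W x) = x := fun x => by
    have := congrArg (fun T : H2 →L[ℂ] H2 => T x) hWu.2
    simpa [star_eq_adjoint] using this
  have hp : ∀ x, W23 (W12 x) = W12 (W13 (W23 x)) := fun x => by
    have := congrArg (fun T : H3 →L[ℂ] H3 => T x) hpent
    simpa using this
  -- inner products of amplified vectors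
  have hMM : ∀ ζ ζ' u c d, ⟪t3.tmul ζ c d, M u ζ'⟫_ℂ = ⟪ζ, ζ'⟫_ℂ * ⟪t2.tmul c d, u⟫_ℂ := by
    intro ζ ζ' u c d
    refine t2.induct (p := fun u => ⟪t3.tmul ζ c d, M u ζ'⟫_ℂ
      = ⟪ζ, ζ'⟫_ℂ * ⟪t2.tmul c d, u⟫_ℂ) ?_ ?_ ?_ ?_ u
    · exact isClosed_eq (by fun_prop) (by fun_prop)
    · intro a' b'; rw [hM, t3.inner_tmul, t2.inner_tmul, mul_assoc]
    · intro x y h1 h2; simp only [map_add, add_apply, inner_add_right, h1, h2, mul_add]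
    · intro c x h1; simp only [map_smul, smul_apply, inner_smul_right, h1]; ring
  have h23 : ∀ ζ u, W23 (M u ζ) = M (W u) ζ := by
    intro ζ u
    refine t2.induct (p := fun u => W23 (M u ζ) = M (W u) ζ) ?_ ?_ ?_ ?_ u
    · exact isClosed_eq (by fun_prop) (by fun_prop)
    · intro a' b'
      refine t3.ext_left fun x y z => ?_
      rw [hMM, hM, hW23, mul_comm]
    · intro x y h1 h2; simp only [map_add, add_apply, h1, h2]
    · intro c x h1; simp only [map_smul, smul_apply, h1]
  have h23' : ∀ ζ u, adjoint W23 (M u ζ) = M (adjoint W u) ζ := by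
    intro ζ u
    refine t3.ext_left fun x y z => ?_
    rw [adjoint_inner_right, hMM, adjoint_inner_right, ← hM y z x, h23]
    generalize W (t2.tmul y z) = v
    refine t2.induct (p := fun v => ⟪M v x, M u ζ⟫_ℂ = ⟪x, ζ⟫_ℂ * ⟪v, u⟫_ℂ) ?_ ?_ ?_ ?_ v
    · exact isClosed_eq (by fun_prop) (by fun_prop)
    · intro a' b'; rw [hM, hMM]
    · intro x y h1 h2; simp only [map_add, add_apply, inner_add_left, h1, h2, mul_add]
    · intro c x h1; simp only [map_smul, smul_apply, inner_smul_left, h1]; ring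
  have h12 : ∀ u, adjoint W12 (R u) = R (adjoint W u) := by
    have hRR : ∀ u c d e, ⟪t3.tmul c d e, R u⟫_ℂ = ⟪t2.tmul c d, u⟫_ℂ * ⟪e, ξ'⟫_ℂ := by
      intro u c d e
      refine t2.induct (p := fun u => ⟪t3.tmul c d e, R u⟫_ℂ
        = ⟪t2.tmul c d, u⟫_ℂ * ⟪e, ξ'⟫_ℂ) ?_ ?_ ?_ ?_ u
      · exact isClosed_eq (by fun_prop) (by fun_prop)
      · intro a' b'; rw [hR, t3.inner_tmul, t2.inner_tmul]
      · intro x y h1 h2; simp only [map_add, inner_add_right, h1, h2, add_mul]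
      · intro c x h1; simp only [map_smul, inner_smul_right, h1]; ring
    intro u
    refine t3.ext_left fun x y z => ?_
    rw [hRR, adjoint_inner_right, adjoint_inner_right]
    refine t2.induct (p := fun u => ⟪W12 (t3.tmul x y z), R u⟫_ℂ
        = ⟪W (t2.tmul x y), u⟫_ℂ * ⟪z, ξ'⟫_ℂ) ?_ ?_ ?_ ?_ u
    · exact isClosed_eq (by fun_prop) (by fun_prop)
    · intro a' b'
      rw [hR, ← inner_conj_symm, hW12, map_mul, inner_conj_symm, inner_conj_symm]
    · intro x y h1 h2; simp only [map_add, inner_add_right, h1, h2, add_mul]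
    · intro c x h1; simp only [map_smul, inner_smul_right, h1]; ring
  have h13 : ∀ u ζ', ⟪R u, W13 (t3.tmul ζ' η η')⟫_ℂ = ⟪u, t2.tmul (b ζ') η⟫_ℂ := by
    intro u ζ'
    refine t2.induct (p := fun u => ⟪R u, W13 (t3.tmul ζ' η η')⟫_ℂ
        = ⟪u, t2.tmul (b ζ') η⟫_ℂ) ?_ ?_ ?_ ?_ u
    · exact isClosed_eq (by fun_prop) (by fun_prop)
    · intro a' b'
      rw [hR, hW13, t2.inner_tmul, hb]
    · intro x y h1 h2; simp only [map_add, inner_add_left, h1, h2]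
    · intro c x h1; simp only [map_smul, inner_smul_left, h1]
  let Q : H2 → H2 → (H →L[ℂ] H) := fun u v => adjoint (M u) ∘L W12 ∘L M v
  have hab : a * b = Q (adjoint W (t2.tmul ξ ξ')) (adjoint W (t2.tmul η η')) := by
    ext ζ'
    refine ext_inner_left ℂ fun ζ => ?_
    simp only [Q, coe_comp, Function.comp_apply]
    rw [show (a * b) ζ' = a (b ζ') from rfl, ha, adjoint_inner_right, ← h23', adjoint_inner_left, hp, h23, hWW, hM, hM, ← hR,
      ← adjoint_inner_left, ← adjoint_inner_left W12, h12, h13]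
  rw [hab]
  let K : Submodule ℂ (H →L[ℂ] H) := (Submodule.span ℂ (slicesR t2 t2 W)).topologicalClosure
  have hK : ∀ T, T ∈ hatA t2 W ↔ T ∈ K := fun T => Iff.rfl
  have hKc : IsClosed (K : Set (H →L[ℂ] H)) := Submodule.isClosed_topologicalClosure _
  rw [hK]
  generalize adjoint W (t2.tmul ξ ξ') = u
  generalize adjoint W (t2.tmul η η') = v
  refine t2.induct (p := fun u => Q u v ∈ K) ?_ ?_ ?_ ?_ u
  · refine hKc.preimage (f := fun u => Q u v) ?_
    have : Continuous fun u => adjoint (M u) := (LinearIsometryEquiv.continuous _).comp M.continuous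
    exact this.clm_comp continuous_const
  · intro c d
    refine t2.induct (p := fun v => Q (t2.tmul c d) v ∈ K) ?_ ?_ ?_ ?_ v
    · refine hKc.preimage (f := fun v => Q (t2.tmul c d) v) ?_
      exact continuous_const.clm_comp (continuous_const.clm_comp M.continuous)
    · intro c' d'
      obtain ⟨T, hT⟩ := exists_slice t2 W c c'
      have : Q (t2.tmul c d) (t2.tmul c' d') = ⟪d, d'⟫_ℂ • T := by
        ext ζ'
        refine ext_inner_left ℂ fun ζ => ?_
        simp only [Q, coe_comp, Function.comp_apply, smul_apply]
        rw [adjoint_inner_right, hM, hM, hW12, inner_smul_right, hT, mul_comm]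
      rw [this]
      exact K.smul_mem _ (Submodule.le_topologicalClosure _ (Submodule.subset_span ⟨c, c', hT⟩))
    · intro x y h1 h2
      have : Q (t2.tmul c d) (x + y) = Q (t2.tmul c d) x + Q (t2.tmul c d) y := by
        ext; simp [Q]
      rw [this]; exact K.add_mem h1 h2
    · intro r x h1
      have : Q (t2.tmul c d) (r • x) = r • Q (t2.tmul c d) x := by
        ext; simp [Q]
      rw [this]; exact K.smul_mem _ h1
  · intro x y h1 h2
    have : Q (x + y) v = Q x v + Q y v := by
      ext; simp [Q]
    rw [this]; exact K.add_mem h1 h2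
  · intro r x h1
    have : Q (r • x) v = (starRingEnd ℂ r) • Q x v := by
      simp only [Q, map_smul, LinearIsometryEquiv.map_smulₛₗ, smul_comp]
    rw [this]; exact K.smul_mem _ h1

end Helpers

/-- For a multiplicative unitary `W` on `H`, the space
`Â(W) = [(id ⊗ ω_{ξ,η})(W)]` is a norm-closed subalgebra of `B(H)` acting
non-degenerately on `H`. -/
theorem statement0
    {H H2 H3 : Type*}
    [NormedAddCommGroup H] [InnerProductSpace ℂ H] [CompleteSpace H]
    [NormedAddCommGroup H2] [InnerProductSpace ℂ H2] [CompleteSpace H2]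
    [NormedAddCommGroup H3] [InnerProductSpace ℂ H3] [CompleteSpace H3]
    -- realizations of the tensor products H ⊗ H and H ⊗ H ⊗ H
    (t2 : TensorPair H H H2) (t3 : TensorTriple H H H H3)
    -- W is a unitary on H ⊗ H
    (W : H2 →L[ℂ] H2) (hWu : star W * W = 1 ∧ W * star W = 1)
    -- the legs W₁₂, W₂₃, W₁₃ of W on H ⊗ H ⊗ H
    (W12 W23 W13 : H3 →L[ℂ] H3)
    (hW12 : IsLeg12 t2 t3 W W12) (hW23 : IsLeg23 t2 t3 W W23)
    (hW13 : IsLeg13 t2 t3 W W13)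
    -- the pentagon equation W₂₃W₁₂ = W₁₂W₁₃W₂₃
    (hpent : W23 * W12 = W12 * W13 * W23)
    :
    (∀ a ∈ hatA t2 W, ∀ b ∈ hatA t2 W, a * b ∈ hatA t2 W) ∧
    IsClosed (hatA t2 W) ∧
    Dense (Submodule.span ℂ {x : H | ∃ a ∈ hatA t2 W, ∃ ζ : H, x = a ζ} : Set H) := by

  let K : Submodule ℂ (H →L[ℂ] H) := (Submodule.span ℂ (slicesR t2 t2 W)).topologicalClosure
  have hK : ∀ T, T ∈ hatA t2 W ↔ T ∈ K := fun T => Iff.rfl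
  have hKc : IsClosed (K : Set (H →L[ℂ] H)) := Submodule.isClosed_topologicalClosure _
  refine ⟨?_, isClosed_closure, ?_⟩
  · intro a ha b hb
    refine closed_span_induction (p := fun a => a * b ∈ K) ?_ ?_ ?_ ?_ ?_ ha
    · exact hKc.preimage (f := fun a => a * b) (by fun_prop)
    · intro a ha
      refine closed_span_induction (p := fun b => a * b ∈ K) ?_ ?_ ?_ ?_ ?_ hb
      · exact hKc.preimage (f := fun b => a * b) (by fun_prop)
      · intro b hb
        exact slice_mul t2 t3 W hWu W12 W23 W13 hW12 hW23 hW13 hpent a b ha hb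
      · simp
      · intro x y h1 h2; rw [mul_add]; exact K.add_mem h1 h2
      · intro c x h1; rw [mul_smul_comm]; exact K.smul_mem _ h1
    · simp
    · intro x y h1 h2; rw [add_mul]; exact K.add_mem h1 h2
    · intro c x h1; rw [smul_mul_assoc]; exact K.smul_mem _ h1
  · rw [Submodule.dense_iff_topologicalClosure_eq_top, Submodule.topologicalClosure_eq_top_iff,
      Submodule.eq_bot_iff]
    intro x hx
    have h0 : adjoint W (t2.tmul x x) = 0 := by
      refine t2.ext_left fun ζ η => ?_
      obtain ⟨T, hT⟩ := exists_slice t2 W x η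
      have hTK : T ∈ hatA t2 W := Submodule.le_topologicalClosure _
        (Submodule.subset_span ⟨x, η, hT⟩)
      have := (Submodule.mem_orthogonal' _ _).1 hx (T ζ)
        (Submodule.subset_span ⟨T, hTK, ζ, rfl⟩)
      rw [hT] at this
      rw [adjoint_inner_right, inner_zero_right, ← inner_conj_symm, this, map_zero]
    have h1 : W (adjoint W (t2.tmul x x)) = t2.tmul x x := by
      have := congrArg (fun T : H2 →L[ℂ] H2 => T (t2.tmul x x)) hWu.2
      simpa [star_eq_adjoint] using this
    rw [h0, map_zero] at h1
    have h2 := t2.norm_tmul x x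
    rw [← h1, norm_zero] at h2
    simpa using h2.symm

end
end

section
/- Let W be a multiplicative unitary on a complex Hilbert space H. Then A(W) is a norm-closed subalgebra of B(H) (it is closed under operator composition), and it acts non-degenerately on H: the linear span of {a ζ : a ∈ A(W), ζ ∈ H} is dense in H. -/
/-!
Common framework: we axiomatize realizations of Hilbert-space tensor products.
A `TensorPair E F EF` realizes the Hilbert tensor product `E ⊗ F` as the Hilbert
space `EF`: it consists of a bilinear map `(a, b) ↦ a ⊗ b` whose image satisfies
the characteristic inner-product identity and has total (dense) linear span.
Operators such as the leg operators `X₁₂`, `X₂₃`, `X₁₃`, amplifications `a ⊗ b`,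
and the tensor flip `Σ` are then uniquely characterized by their matrix
coefficients against elementary tensors.
-/

noncomputable section

open scoped InnerProductSpace
open ContinuousLinearMap

section Helpers

open scoped TensorProduct

variable {C E F G EF : Type*}
    [NormedAddCommGroup C] [InnerProductSpace ℂ C]
    [NormedAddCommGroup E] [InnerProductSpace ℂ E]
    [NormedAddCommGroup F] [InnerProductSpace ℂ F]
    [NormedAddCommGroup G] [InnerProductSpace ℂ G]
    [NormedAddCommGroup EF] [InnerProductSpace ℂ EF]

theorem aux_clm_ext (t : TensorPair E F EF) {f g : EF →L[ℂ] G}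
    (h : ∀ a b, f (t.tmul a b) = g (t.tmul a b)) : f = g := by
  refine ContinuousLinearMap.ext_on t.dense_span ?_
  rintro _ ⟨a, b, rfl⟩
  exact h a b

/-- A closed submodule property holds everywhere once it holds on elementary tensors. -/
theorem aux_induct (t : TensorPair E F EF) {p : EF → Prop} (hc : IsClosed {x | p x})
    (h0 : p 0) (hadd : ∀ x y, p x → p y → p (x + y)) (hs : ∀ (c : ℂ) x, p x → p (c • x))
    (ht : ∀ a b, p (t.tmul a b)) (x : EF) : p x := by
  have h1 : (Submodule.span ℂ {z : EF | ∃ a b, z = t.tmul a b} : Set EF) ⊆ {x | p x} := by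
    intro z hz
    induction hz using Submodule.span_induction with
    | mem z hz => obtain ⟨a, b, rfl⟩ := hz; exact ht a b
    | zero => exact h0
    | add x y _ _ hx hy => exact hadd x y hx hy
    | smul c x _ hx => exact hs c x hx
  exact closure_minimal h1 hc (t.dense_span x)

theorem aux_embed [CompleteSpace G] (t : TensorPair E F EF) (f : C →ₗ[ℂ] E →ₗ[ℂ] F →ₗ[ℂ] G)
    (hf : ∀ c c' a a' b b', ⟪f c a b, f c' a' b'⟫_ℂ = ⟪c, c'⟫_ℂ * (⟪a, a'⟫_ℂ * ⟪b, b'⟫_ℂ)) :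
    ∃ V : C →L[ℂ] EF →L[ℂ] G, (∀ c a b, V c (t.tmul a b) = f c a b) ∧
      ∀ c c' x y, ⟪V c x, V c' y⟫_ℂ = ⟪c, c'⟫_ℂ * ⟪x, y⟫_ℂ := by
  let e : TensorProduct ℂ E F →ₗ[ℂ] EF := TensorProduct.lift t.tmul
  let g : C → (TensorProduct ℂ E F →ₗ[ℂ] G) := fun c => TensorProduct.lift (f c)
  have hg : ∀ c z w, ⟪g c z, g c w⟫_ℂ = ⟪c, c⟫_ℂ * ⟪e z, e w⟫_ℂ := by
    intro c z w
    induction z using TensorProduct.induction_on with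
    | zero => simp
    | add x y hx hy => simp only [map_add, inner_add_left, hx, hy, mul_add]
    | tmul a b =>
      induction w using TensorProduct.induction_on with
      | zero => simp
      | add x y hx hy => simp only [map_add, inner_add_right, hx, hy, mul_add]
      | tmul a' b' => simp only [g, e, TensorProduct.lift.tmul, hf, t.inner_tmul]
  have hn : ∀ c z, ‖g c z‖ ≤ ‖c‖ * ‖e z‖ := by
    intro c z
    have h := hg c z z
    simp only [inner_self_eq_norm_sq_to_K] at h
    have h' : ‖g c z‖ ^ 2 = ‖c‖ ^ 2 * ‖e z‖ ^ 2 := by exact_mod_cast h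
    refine le_of_eq ?_
    rw [← mul_pow] at h'
    exact (sq_eq_sq₀ (norm_nonneg _) (by positivity)).1 h'
  have hd : DenseRange e := by
    refine t.dense_span.mono ?_
    have : Submodule.span ℂ {z : EF | ∃ a b, z = t.tmul a b} ≤ LinearMap.range e := by
      rw [Submodule.span_le]
      rintro _ ⟨a, b, rfl⟩
      exact ⟨a ⊗ₜ[ℂ] b, by simp [e]⟩
    exact this
  let L : C → (EF →L[ℂ] G) := fun c => (g c).extendOfNorm e
  have hL : ∀ c a b, L c (t.tmul a b) = f c a b := by
    intro c a b
    have := LinearMap.extendOfNorm_eq (f := g c) hd ⟨_, hn c⟩ (a ⊗ₜ[ℂ] b)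
    simpa [e, g] using this
  have hLn : ∀ c x, ‖L c x‖ ≤ ‖c‖ * ‖x‖ := fun c x =>
    LinearMap.norm_extendOfNorm_apply_le hd _ (hn c) x
  let L' : C →ₗ[ℂ] EF →L[ℂ] G :=
    { toFun := L
      map_add' := fun c c' => aux_clm_ext t (by intro a b; simp [hL])
      map_smul' := fun r c => aux_clm_ext t (by intro a b; simp [hL]) }
  let V : C →L[ℂ] EF →L[ℂ] G := L'.mkContinuous 1 (by
    intro c
    rw [one_mul]
    exact (L c).opNorm_le_bound (norm_nonneg _) (hLn c))
  have hV : ∀ c a b, V c (t.tmul a b) = f c a b := hL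
  refine ⟨V, hV, ?_⟩
  intro c c' x y
  refine aux_induct t (p := fun x => ⟪V c x, V c' y⟫_ℂ = ⟪c, c'⟫_ℂ * ⟪x, y⟫_ℂ)
    (isClosed_eq (by fun_prop) (by fun_prop)) (by simp) ?_ ?_ ?_ x
  · intro x x' hx hx'
    simp only [map_add, inner_add_left, hx, hx', mul_add]
  · intro r x hx
    simp only [map_smul, inner_smul_left, hx]; ring
  intro a b
  refine aux_induct t
    (p := fun y => ⟪V c (t.tmul a b), V c' y⟫_ℂ = ⟪c, c'⟫_ℂ * ⟪t.tmul a b, y⟫_ℂ)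
    (isClosed_eq (by fun_prop) (by fun_prop)) (by simp) ?_ ?_ ?_ y
  · intro x x' hx hx'
    simp only [map_add, inner_add_right, hx, hx', mul_add]
  · intro r x hx
    simp only [map_smul, inner_smul_right, hx]; ring
  intro a' b'
  rw [hV, hV, hf, t.inner_tmul]

theorem aux_norm_tmul (t : TensorPair E F EF) (a : E) (b : F) :
    ‖t.tmul a b‖ = ‖a‖ * ‖b‖ := by
  have h := t.inner_tmul a a b b
  simp only [inner_self_eq_norm_sq_to_K] at h
  have h' : ‖t.tmul a b‖ ^ 2 = ‖a‖ ^ 2 * ‖b‖ ^ 2 := by exact_mod_cast h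
  rw [← mul_pow] at h'
  exact (sq_eq_sq₀ (norm_nonneg _) (by positivity)).1 h'

/-- Slices exist. -/
theorem aux_slice [CompleteSpace F] [CompleteSpace EF] (t : TensorPair E F EF) (W : EF →L[ℂ] EF)
    (ξ η : E) : ∃ T : F →L[ℂ] F, ∀ ζ ζ', ⟪ζ, T ζ'⟫_ℂ = ⟪t.tmul ξ ζ, W (t.tmul η ζ')⟫_ℂ := by
  let V : E → (F →L[ℂ] EF) := fun a =>
    (t.tmul a).mkContinuous ‖a‖ (fun b => (aux_norm_tmul t a b).le)
  refine ⟨adjoint (V ξ) ∘L W ∘L V η, ?_⟩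
  intro ζ ζ'
  simp only [ContinuousLinearMap.comp_apply, adjoint_inner_right]
  rfl

theorem aux_inner_ext3 {H3 : Type*} [NormedAddCommGroup H3] [InnerProductSpace ℂ H3]
    (t : TensorTriple C E F H3) {x y : H3}
    (h : ∀ a b c, ⟪t.tmul a b c, x⟫_ℂ = ⟪t.tmul a b c, y⟫_ℂ) : x = y := by
  refine t.dense_span.eq_of_inner_right (𝕜 := ℂ) ?_
  intro v hv
  induction hv using Submodule.span_induction with
  | mem z hz => obtain ⟨a, b, c, rfl⟩ := hz; exact h a b c
  | zero => simp
  | add x y _ _ hx hy => simp only [inner_add_left, hx, hy]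
  | smul c x _ hx => simp only [inner_smul_left, hx]

end Helpers

/-- For a multiplicative unitary `W` on `H`, the space
`A(W) = [(ω_{ξ,η} ⊗ id)(W)]` is a norm-closed subalgebra of `B(H)` acting
non-degenerately on `H`. -/
theorem statement1
    {H H2 H3 : Type*}
    [NormedAddCommGroup H] [InnerProductSpace ℂ H] [CompleteSpace H]
    [NormedAddCommGroup H2] [InnerProductSpace ℂ H2] [CompleteSpace H2]
    [NormedAddCommGroup H3] [InnerProductSpace ℂ H3] [CompleteSpace H3]
    -- realizations of the tensor products H ⊗ H and H ⊗ H ⊗ H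
    (t2 : TensorPair H H H2) (t3 : TensorTriple H H H H3)
    -- W is a unitary on H ⊗ H
    (W : H2 →L[ℂ] H2) (hWu : star W * W = 1 ∧ W * star W = 1)
    -- the legs W₁₂, W₂₃, W₁₃ of W on H ⊗ H ⊗ H
    (W12 W23 W13 : H3 →L[ℂ] H3)
    (hW12 : IsLeg12 t2 t3 W W12) (hW23 : IsLeg23 t2 t3 W W23)
    (hW13 : IsLeg13 t2 t3 W W13)
    -- the pentagon equation W₂₃W₁₂ = W₁₂W₁₃W₂₃
    (hpent : W23 * W12 = W12 * W13 * W23)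
    :
    (∀ a ∈ legA t2 W, ∀ b ∈ legA t2 W, a * b ∈ legA t2 W) ∧
    IsClosed (legA t2 W) ∧
    Dense (Submodule.span ℂ {x : H | ∃ a ∈ legA t2 W, ∃ ζ : H, x = a ζ} : Set H) := by
  obtain ⟨V', hV', hV'i⟩ := aux_embed t2 t3.tmul (by
    intro c c' a a' b b'; rw [t3.inner_tmul, mul_assoc])
  let f12 : H →ₗ[ℂ] H →ₗ[ℂ] H →ₗ[ℂ] H3 :=
    ((LinearMap.lflip (R₀ := ℂ)).toLinearMap ∘ₗ t3.tmul).flip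
  have hf12 : ∀ c a b, f12 c a b = t3.tmul a b c := fun c a b => rfl
  obtain ⟨V, hV, hVi⟩ := aux_embed t2 f12 (by
    intro c c' a a' b b'
    rw [hf12, hf12, t3.inner_tmul]
    ring)
  simp only [hf12] at hV
  have hWi : ∀ x y, ⟪W x, W y⟫_ℂ = ⟪x, y⟫_ℂ := by
    intro x y
    have h := congrArg (fun T : H2 →L[ℂ] H2 => ⟪x, T y⟫_ℂ) hWu.1
    simpa [ContinuousLinearMap.star_eq_adjoint, adjoint_inner_right] using h
  have h12 : ∀ a b c, W12 (t3.tmul a b c) = V c (W (t2.tmul a b)) := by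
    intro a b c
    refine aux_inner_ext3 t3 fun a' b' c' => ?_
    rw [hW12, ← hV c' a' b', hVi, mul_comm]
  have h23 : ∀ a b c, W23 (t3.tmul a b c) = V' a (W (t2.tmul b c)) := by
    intro a b c
    refine aux_inner_ext3 t3 fun a' b' c' => ?_
    rw [hW23, ← hV' a' b' c', hV'i, mul_comm]
  have h12V : ∀ c x, W12 (V c x) = V c (W x) := by
    intro c x
    have : W12 ∘L V c = V c ∘L W := aux_clm_ext t2 (by
      intro a b
      simp only [ContinuousLinearMap.comp_apply, hV, h12])
    exact congrArg (fun T : H2 →L[ℂ] H3 => T x) this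
  -- W12 preserves inner products against elementary tensors
  have h12i : ∀ a b c z, ⟪W12 (t3.tmul a b c), W12 z⟫_ℂ = ⟪t3.tmul a b c, z⟫_ℂ := by
    intro a b c z
    rw [← adjoint_inner_left]
    congr 1
    refine aux_inner_ext3 t3 fun a' b' c' => ?_
    rw [adjoint_inner_right, h12, h12, hVi, hWi, ← hVi, hV, hV]
  let A : Submodule ℂ (H →L[ℂ] H) := (Submodule.span ℂ (slicesL t2 t2 W)).topologicalClosure
  have hA : ∀ T, T ∈ legA t2 W ↔ T ∈ A := fun T => Iff.rfl
  have hAc : IsClosed (A : Set (H →L[ℂ] H)) := Submodule.isClosed_topologicalClosure _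
  have hsA : ∀ T ∈ slicesL t2 t2 W, T ∈ A := fun T hT =>
    Submodule.le_topologicalClosure _ (Submodule.subset_span hT)
  let U : H2 →L[ℂ] H →L[ℂ] H3 := V.flip
  let S : H2 → H2 → (H →L[ℂ] H) := fun x y => adjoint (U x) ∘L (W23 ∘L U y)
  have hS : ∀ x y c c', ⟪c, S x y c'⟫_ℂ = ⟪V c x, W23 (V c' y)⟫_ℂ := by
    intro x y c c'
    simp only [S, U, ContinuousLinearMap.comp_apply, adjoint_inner_right,
      ContinuousLinearMap.flip_apply]
  have hSA : ∀ x y, S x y ∈ A := by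
    intro x y
    refine aux_induct t2 (p := fun x => S x y ∈ A) (hAc.preimage ?_) ?_ ?_ ?_ ?_ x
    · exact ((adjoint.continuous.comp U.continuous).clm_comp continuous_const)
    · simp [S]
    · intro x x' hx hx'
      have : S (x + x') y = S x y + S x' y := by simp [S, ContinuousLinearMap.add_comp]
      rw [this]; exact A.add_mem hx hx'
    · intro r x hx
      have : S (r • x) y = (starRingEnd ℂ r) • S x y := by
        ext c'
        refine ext_inner_left ℂ fun c => ?_
        rw [hS, smul_apply, inner_smul_right, hS, map_smul, inner_smul_left]
      rw [this]; exact A.smul_mem _ hx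
    intro a b
    refine aux_induct t2 (p := fun y => S (t2.tmul a b) y ∈ A) (hAc.preimage ?_) ?_ ?_ ?_ ?_ y
    · exact continuous_const.clm_comp (continuous_const.clm_comp U.continuous)
    · simp [S]
    · intro x x' hx hx'
      have : S (t2.tmul a b) (x + x') = S (t2.tmul a b) x + S (t2.tmul a b) x' := by
        simp [S, ContinuousLinearMap.comp_add]
      rw [this]; exact A.add_mem hx hx'
    · intro r x hx
      have : S (t2.tmul a b) (r • x) = r • S (t2.tmul a b) x := by
        simp [S, ContinuousLinearMap.comp_smul]
      rw [this]; exact A.smul_mem _ hx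
    intro a' b'
    obtain ⟨T, hT⟩ := aux_slice t2 W b b'
    have : S (t2.tmul a b) (t2.tmul a' b') = ⟪a, a'⟫_ℂ • T := by
      ext c'
      refine ext_inner_left ℂ fun c => ?_
      rw [hS, hV, hV, hW23, ContinuousLinearMap.smul_apply, inner_smul_right, hT, mul_comm]
    rw [this]
    exact A.smul_mem _ (hsA T ⟨b, b', hT⟩)
  have hprod : ∀ a ∈ slicesL t2 t2 W, ∀ b ∈ slicesL t2 t2 W, a * b ∈ A := by
    rintro a ⟨ξ₁, η₁, ha⟩ b ⟨ξ₂, η₂, hb⟩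
    have : a * b = S (W (t2.tmul ξ₁ ξ₂)) (W (t2.tmul η₁ η₂)) := by
      ext c'
      refine ext_inner_left ℂ fun c => ?_
      have h1 : ∀ z, ⟪t3.tmul ξ₁ ξ₂ c, W13 (V' η₁ z)⟫_ℂ = ⟪t2.tmul ξ₂ (adjoint a c), z⟫_ℂ := by
        intro z
        have : innerSL ℂ (t3.tmul ξ₁ ξ₂ c) ∘L (W13 ∘L V' η₁)
            = innerSL ℂ (t2.tmul ξ₂ (adjoint a c)) := aux_clm_ext t2 (by
          intro u v
          simp only [ContinuousLinearMap.comp_apply, innerSL_apply_apply]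
          rw [hV', hW13, ← ha, t2.inner_tmul, adjoint_inner_left, mul_comm])
        exact congrArg (fun T : H2 →L[ℂ] ℂ => T z) this
      have h2 : ∀ z, W23 (W12 z) = W12 (W13 (W23 z)) := fun z =>
        congrArg (fun T : H3 →L[ℂ] H3 => T z) hpent
      rw [hS, ← h12, ← h12, h2, h12i, h23, h1, ← hb, adjoint_inner_left]
      rfl
    rw [this]
    exact hSA _ _
  refine ⟨?_, isClosed_closure, ?_⟩
  · have step1 : ∀ a ∈ slicesL t2 t2 W, ∀ b ∈ A, a * b ∈ A := by
      intro a ha b hb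
      have hsp : (Submodule.span ℂ (slicesL t2 t2 W) : Set (H →L[ℂ] H)) ⊆ {b | a * b ∈ A} := by
        intro b hb
        induction hb using Submodule.span_induction with
        | mem z hz => exact hprod a ha z hz
        | zero => simp
        | add x y _ _ hx hy =>
          simp only [Set.mem_setOf_eq, mul_add] at *
          exact A.add_mem hx hy
        | smul c x _ hx =>
          simp only [Set.mem_setOf_eq, mul_smul_comm] at *
          exact A.smul_mem _ hx
      exact closure_minimal hsp (hAc.preimage (continuous_const.mul continuous_id)) hb
    intro a ha b hb
    have hsp : (Submodule.span ℂ (slicesL t2 t2 W) : Set (H →L[ℂ] H)) ⊆ {a | a * b ∈ A} := by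
      intro a ha
      induction ha using Submodule.span_induction with
      | mem z hz => exact step1 z hz b hb
      | zero => simp
      | add x y _ _ hx hy =>
        simp only [Set.mem_setOf_eq, add_mul] at *
        exact A.add_mem hx hy
      | smul c x _ hx =>
        simp only [Set.mem_setOf_eq, smul_mul_assoc] at *
        exact A.smul_mem _ hx
    exact closure_minimal hsp (hAc.preimage (continuous_id.mul continuous_const)) ha
  · rw [Submodule.dense_iff_topologicalClosure_eq_top, Submodule.topologicalClosure_eq_top_iff,
      Submodule.eq_bot_iff]
    intro v hv
    rw [Submodule.mem_orthogonal'] at hv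
    have h0 : adjoint W (t2.tmul v v) = 0 := by
      have : innerSL ℂ (adjoint W (t2.tmul v v)) = 0 := aux_clm_ext t2 (by
        intro η ζ
        obtain ⟨T, hT⟩ := aux_slice t2 W v η
        rw [innerSL_apply_apply, adjoint_inner_left, ← hT]
        exact hv _ (Submodule.subset_span ⟨T, hsA T ⟨v, η, hT⟩, ζ, rfl⟩))
      have h := congrArg (fun T : H2 →L[ℂ] ℂ => T (adjoint W (t2.tmul v v))) this
      simpa using h
    have h1 : t2.tmul v v = 0 := by
      have h := congrArg (fun T : H2 →L[ℂ] H2 => T (t2.tmul v v)) hWu.2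
      simp only [ContinuousLinearMap.mul_apply, ContinuousLinearMap.star_eq_adjoint, h0, map_zero,
        ContinuousLinearMap.one_apply] at h
      exact h.symm
    have h2 := aux_norm_tmul t2 v v
    rw [h1, norm_zero] at h2
    exact norm_eq_zero.1 (mul_self_eq_zero.1 h2.symm)

end
end

section
/- Let W be a multiplicative unitary on a complex Hilbert space H. Then C(W) is a norm-closed subalgebra of B(H): the composition of any two elements of C(W) again lies in C(W). -/
/-!
Common framework: we axiomatize realizations of Hilbert-space tensor products.
A `TensorPair E F EF` realizes the Hilbert tensor product `E ⊗ F` as the Hilbert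
space `EF`: it consists of a bilinear map `(a, b) ↦ a ⊗ b` whose image satisfies
the characteristic inner-product identity and has total (dense) linear span.
Operators such as the leg operators `X₁₂`, `X₂₃`, `X₁₃`, amplifications `a ⊗ b`,
and the tensor flip `Σ` are then uniquely characterized by their matrix
coefficients against elementary tensors.
-/

noncomputable section

open scoped InnerProductSpace
open ContinuousLinearMap

theorem dense_span_ind {V : Type*} [NormedAddCommGroup V] [NormedSpace ℂ V] {S : Set V}
    (hS : Dense (Submodule.span ℂ S : Set V)) {p : V → Prop} (hc : IsClosed {x | p x})
    (h0 : p 0) (hadd : ∀ x y, p x → p y → p (x + y)) (hsmul : ∀ (c : ℂ) x, p x → p (c • x))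
    (hmem : ∀ x ∈ S, p x) (x : V) : p x := by
  have h1 : (Submodule.span ℂ S : Set V) ⊆ {x | p x} := by
    intro y hy
    exact Submodule.span_induction (p := fun y _ => p y) hmem h0
      (fun x y _ _ hx hy => hadd x y hx hy) (fun c x _ hx => hsmul c x hx) hy
  have h2 := closure_minimal h1 hc
  exact h2 (hS x)

theorem pair_inner_ext {V : Type*} [NormedAddCommGroup V] [InnerProductSpace ℂ V] {S : Set V}
    (hS : Dense (Submodule.span ℂ S : Set V)) {x y : V} (h : ∀ z ∈ S, ⟪z, x⟫_ℂ = ⟪z, y⟫_ℂ) :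
    x = y := by
  refine ext_inner_left ℂ fun v => ?_
  refine dense_span_ind hS (p := fun v => ⟪v, x⟫_ℂ = ⟪v, y⟫_ℂ) ?_ ?_ ?_ ?_ h v
  · exact isClosed_eq (by fun_prop) (by fun_prop)
  · simp
  · intro u w hu hw; simp only [inner_add_left, hu, hw]
  · intro c u hu; simp only [inner_smul_left, hu]

/-- The canonical bounded bilinear map `(u, c) ↦ u ⊗ c`. -/
theorem exists_amp_s2 {H H2 H3 : Type*}
    [NormedAddCommGroup H] [InnerProductSpace ℂ H]
    [NormedAddCommGroup H2] [InnerProductSpace ℂ H2]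
    [NormedAddCommGroup H3] [InnerProductSpace ℂ H3] [CompleteSpace H3]
    (t2 : TensorPair H H H2) (tri : H →ₗ[ℂ] H →ₗ[ℂ] H →ₗ[ℂ] H3)
    (htri : ∀ a a' b b' c c' : H,
      ⟪tri a b c, tri a' b' c'⟫_ℂ = ⟪a, a'⟫_ℂ * ⟪b, b'⟫_ℂ * ⟪c, c'⟫_ℂ) :
    ∃ L : H2 →L[ℂ] H →L[ℂ] H3, (∀ a b c, L (t2.tmul a b) c = tri a b c) ∧
      ∀ u u' c c', ⟪L u c, L u' c'⟫_ℂ = ⟪u, u'⟫_ℂ * ⟪c, c'⟫_ℂ := by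
  let J : TensorProduct ℂ H H →ₗ[ℂ] H2 := TensorProduct.lift t2.tmul
  let G : TensorProduct ℂ H H →ₗ[ℂ] H →ₗ[ℂ] H3 := TensorProduct.lift tri
  have hin : ∀ x y c c', ⟪G x c, G y c'⟫_ℂ = ⟪J x, J y⟫_ℂ * ⟪c, c'⟫_ℂ := by
    intro x y c c'
    induction x with
    | zero => simp
    | add x x' hx hx' =>
      simp only [map_add, LinearMap.add_apply, inner_add_left, hx, hx', add_mul]
    | tmul a b =>
      induction y with
      | zero => simp
      | add x x' hx hx' =>
        simp only [map_add, LinearMap.add_apply, inner_add_right, hx, hx', add_mul]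
      | tmul a' b' =>
        simp only [G, J, TensorProduct.lift.tmul, htri, t2.inner_tmul]
  have hnorm : ∀ x c, ‖G x c‖ ≤ ‖J x‖ * ‖c‖ := by
    intro x c
    have h := hin x x c c
    rw [inner_self_eq_norm_sq_to_K, inner_self_eq_norm_sq_to_K, inner_self_eq_norm_sq_to_K] at h
    have h' : ‖G x c‖ ^ 2 = ‖J x‖ ^ 2 * ‖c‖ ^ 2 := by exact_mod_cast h
    rw [← mul_pow] at h'
    exact le_of_eq ((sq_eq_sq₀ (norm_nonneg _) (by positivity)).1 h')
  let F : TensorProduct ℂ H H →ₗ[ℂ] H →L[ℂ] H3 :=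
    { toFun := fun x => (G x).mkContinuous ‖J x‖ (hnorm x)
      map_add' := by intro x y; ext c; simp
      map_smul' := by intro k x; ext c; simp }
  have hF : ∀ x, ‖F x‖ ≤ 1 * ‖J x‖ := by
    intro x
    rw [one_mul]
    exact LinearMap.mkContinuous_norm_le _ (norm_nonneg _) (hnorm x)
  have hd : DenseRange J := by
    refine t2.dense_span.mono ?_
    have : Submodule.span ℂ {z : H2 | ∃ a b, z = t2.tmul a b} ≤ LinearMap.range J := by
      rw [Submodule.span_le]
      rintro _ ⟨a, b, rfl⟩
      exact ⟨TensorProduct.tmul ℂ a b, by simp [J]⟩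
    exact this
  have hL : ∀ a b c, F.extendOfNorm J (t2.tmul a b) c = tri a b c := by
    intro a b c
    have h := LinearMap.extendOfNorm_eq hd ⟨1, hF⟩ (TensorProduct.tmul ℂ a b)
    have hJ : J (TensorProduct.tmul ℂ a b) = t2.tmul a b := by simp [J]
    rw [hJ] at h
    rw [h]
    simp [F, G]
  refine ⟨F.extendOfNorm J, hL, ?_⟩
  intro u u' c c'
  have hJF : ∀ x, F.extendOfNorm J (J x) = F x := fun x => LinearMap.extendOfNorm_eq hd ⟨1, hF⟩ x
  refine hd.induction_on₂ (p := fun u u' =>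
    ⟪F.extendOfNorm J u c, F.extendOfNorm J u' c'⟫_ℂ = ⟪u, u'⟫_ℂ * ⟪c, c'⟫_ℂ) ?_ ?_ u u'
  · exact isClosed_eq (by fun_prop) (by fun_prop)
  · intro x y
    rw [hJF, hJF]
    exact hin x y c c'

/-- For a multiplicative unitary `W` on `H`, the space
`C(W) = [(id ⊗ ω_{ξ,η})(ΣW)]` is a norm-closed subalgebra of `B(H)`. -/
theorem statement2
    {H H2 H3 : Type*}
    [NormedAddCommGroup H] [InnerProductSpace ℂ H] [CompleteSpace H]
    [NormedAddCommGroup H2] [InnerProductSpace ℂ H2] [CompleteSpace H2]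
    [NormedAddCommGroup H3] [InnerProductSpace ℂ H3] [CompleteSpace H3]
    -- realizations of the tensor products H ⊗ H and H ⊗ H ⊗ H
    (t2 : TensorPair H H H2) (t3 : TensorTriple H H H H3)
    -- W is a unitary on H ⊗ H
    (W : H2 →L[ℂ] H2) (hWu : star W * W = 1 ∧ W * star W = 1)
    -- the legs W₁₂, W₂₃, W₁₃ of W on H ⊗ H ⊗ H
    (W12 W23 W13 : H3 →L[ℂ] H3)
    (hW12 : IsLeg12 t2 t3 W W12) (hW23 : IsLeg23 t2 t3 W W23)
    (hW13 : IsLeg13 t2 t3 W W13)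
    -- the pentagon equation W₂₃W₁₂ = W₁₂W₁₃W₂₃
    (hpent : W23 * W12 = W12 * W13 * W23)
    -- the tensor flip Σ on H ⊗ H
    (Sg : H2 →L[ℂ] H2) (hSg : ∀ a b : H, Sg (t2.tmul a b) = t2.tmul b a)
    :
    (∀ a ∈ hatA t2 (Sg * W), ∀ b ∈ hatA t2 (Sg * W), a * b ∈ hatA t2 (Sg * W)) ∧
    IsClosed (hatA t2 (Sg * W)) := by
  refine ⟨?_, isClosed_closure⟩
  obtain ⟨L, hLt, hLi⟩ := exists_amp_s2 t2 t3.tmul t3.inner_tmul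
  let tri' : H →ₗ[ℂ] H →ₗ[ℂ] H →ₗ[ℂ] H3 :=
    { toFun := fun b => (t3.tmul.flip b).flip
      map_add' := by intro x y; ext; simp
      map_smul' := by intro k x; ext; simp }
  have htri' : ∀ a b c, tri' b c a = t3.tmul a b c := fun a b c => rfl
  obtain ⟨R, hRt, hRi⟩ := exists_amp_s2 t2 tri' (by
    intro a a' b b' c c'
    rw [htri', htri', t3.inner_tmul]
    ring)
  have hRt' : ∀ a b c, R (t2.tmul b c) a = t3.tmul a b c := fun a b c => by
    rw [hRt, htri']
  have hC : hatA t2 (Sg * W) =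
      ((Submodule.span ℂ (slicesR t2 t2 (Sg * W))).topologicalClosure : Set (H →L[ℂ] H)) := rfl
  set C := (Submodule.span ℂ (slicesR t2 t2 (Sg * W))).topologicalClosure with hCdef
  rw [hC]
  -- flip
  have hflip : ∀ a b z, ⟪t2.tmul a b, Sg z⟫_ℂ = ⟪t2.tmul b a, z⟫_ℂ := by
    intro a b z
    refine dense_span_ind t2.dense_span
      (p := fun z => ⟪t2.tmul a b, Sg z⟫_ℂ = ⟪t2.tmul b a, z⟫_ℂ) ?_ ?_ ?_ ?_ ?_ z
    · exact isClosed_eq (by fun_prop) (by fun_prop)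
    · simp
    · intro x y hx hy; simp only [map_add, inner_add_right, hx, hy]
    · intro k x hx; simp only [map_smul, inner_smul_right, hx]
    · rintro _ ⟨x, y, rfl⟩
      rw [hSg, t2.inner_tmul, t2.inner_tmul, mul_comm]
  -- legs acting on amplified vectors
  have h12 : ∀ a b c, W12 (t3.tmul a b c) = L (W (t2.tmul a b)) c := by
    intro a b c
    refine pair_inner_ext t3.dense_span ?_
    rintro _ ⟨x, y, z, rfl⟩
    rw [hW12, ← hLt x y z, hLi]
  have h23 : ∀ a b c, W23 (t3.tmul a b c) = R (W (t2.tmul b c)) a := by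
    intro a b c
    refine pair_inner_ext t3.dense_span ?_
    rintro _ ⟨x, y, z, rfl⟩
    rw [hW23, ← hRt' x y z, hRi]
  have h12s : ∀ u c, adjoint W12 (L u c) = L (adjoint W u) c := by
    intro u c
    refine pair_inner_ext t3.dense_span ?_
    rintro _ ⟨x, y, z, rfl⟩
    rw [adjoint_inner_right, h12, hLi, ← hLt x y z, hLi, adjoint_inner_right]
  let T : H2 → H2 → (H →L[ℂ] H) := fun u v => adjoint (L u) ∘L W13 ∘L R v
  have hTval : ∀ u v ζ ζ', ⟪ζ, T u v ζ'⟫_ℂ = ⟪L u ζ, W13 (R v ζ')⟫_ℂ := by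
    intro u v ζ ζ'
    simp [T, adjoint_inner_right]
  -- slices exist
  have hT0 : ∀ g h e f, T (t2.tmul g h) (t2.tmul e f) ∈ C := by
    intro g h e f
    by_cases hz : ⟪h, e⟫_ℂ = 0
    · have : T (t2.tmul g h) (t2.tmul e f) = 0 := by
        ext ζ'
        refine ext_inner_left ℂ fun ζ => ?_
        rw [hTval, hLt, hRt', hW13, hz]; simp
      rw [this]; exact C.zero_mem
    · have : (⟪h, e⟫_ℂ)⁻¹ • T (t2.tmul g h) (t2.tmul e f) ∈ C := by
        refine Submodule.le_topologicalClosure _ (Submodule.subset_span ⟨g, f, fun ζ ζ' => ?_⟩)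
        rw [ContinuousLinearMap.smul_apply, inner_smul_right, hTval, hLt, hRt', hW13,
          ContinuousLinearMap.mul_apply, hflip]
        field_simp
      have h2 := C.smul_mem (⟪h, e⟫_ℂ) this
      rwa [smul_smul, mul_inv_cancel₀ hz, one_smul] at h2
  have hCcl : IsClosed (C : Set (H →L[ℂ] H)) := Submodule.isClosed_topologicalClosure _
  have hT1 : ∀ g h v, T (t2.tmul g h) v ∈ C := by
    intro g h v
    refine dense_span_ind t2.dense_span (p := fun v => T (t2.tmul g h) v ∈ C) ?_ ?_ ?_ ?_ ?_ v
    · exact hCcl.preimage (by fun_prop)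
    · simp [T]
    · intro x y hx hy
      have : T (t2.tmul g h) (x + y) = T (t2.tmul g h) x + T (t2.tmul g h) y := by simp [T]
      rw [this]; exact C.add_mem hx hy
    · intro k x hx
      have : T (t2.tmul g h) (k • x) = k • T (t2.tmul g h) x := by simp [T]
      rw [this]; exact C.smul_mem k hx
    · rintro _ ⟨e, f, rfl⟩
      exact hT0 g h e f
  have hT2 : ∀ u v, T u v ∈ C := by
    intro u v
    refine dense_span_ind t2.dense_span (p := fun u => T u v ∈ C) ?_ ?_ ?_ ?_ ?_ u
    · refine hCcl.preimage ?_
      have : Continuous fun u => adjoint (L u) := (adjoint (𝕜 := ℂ) (E := H) (F := H3)).continuous.comp L.continuous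
      exact this.clm_comp continuous_const
    · simp [T]
    · intro x y hx hy
      have : T (x + y) v = T x v + T y v := by simp [T]
      rw [this]; exact C.add_mem hx hy
    · intro k x hx
      have : T (k • x) v = (starRingEnd ℂ k) • T x v := by
        ext ζ'
        refine ext_inner_left ℂ fun ζ => ?_
        rw [hTval, smul_apply, inner_smul_right, hTval, map_smul, smul_apply, inner_smul_left]
      rw [this]; exact C.smul_mem _ hx
    · rintro _ ⟨e, f, rfl⟩
      exact hT1 e f v
  -- product of slices
  have hprod : ∀ a ∈ slicesR t2 t2 (Sg * W), ∀ b ∈ slicesR t2 t2 (Sg * W), a * b ∈ C := by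
    rintro a ⟨ξ, η, ha⟩ b ⟨ξ', η', hb⟩
    have ha' : ∀ ζ y, ⟪ζ, a y⟫_ℂ = ⟪t2.tmul ξ ζ, W (t2.tmul y η)⟫_ℂ := fun ζ y => by
      rw [ha, ContinuousLinearMap.mul_apply, hflip]
    have hb' : ∀ ζ y, ⟪ζ, b y⟫_ℂ = ⟪t2.tmul ξ' ζ, W (t2.tmul y η')⟫_ℂ := fun ζ y => by
      rw [hb, ContinuousLinearMap.mul_apply, hflip]
    have key : ∀ ζ z, ⟪t3.tmul ξ' ξ ζ, W23 (L z η)⟫_ℂ = ⟪t2.tmul ξ' (adjoint a ζ), z⟫_ℂ := by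
      intro ζ z
      refine dense_span_ind t2.dense_span (p := fun z =>
        ⟪t3.tmul ξ' ξ ζ, W23 (L z η)⟫_ℂ = ⟪t2.tmul ξ' (adjoint a ζ), z⟫_ℂ) ?_ ?_ ?_ ?_ ?_ z
      · exact isClosed_eq (by fun_prop) (by fun_prop)
      · simp
      · intro x y hx hy
        simp only [map_add, ContinuousLinearMap.add_apply, inner_add_right, hx, hy]
      · intro k x hx
        simp only [map_smul, ContinuousLinearMap.smul_apply, inner_smul_right, hx]
      · rintro _ ⟨x, y, rfl⟩
        rw [hLt, hW23, t2.inner_tmul, adjoint_inner_left, ha', mul_comm]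
    have : a * b = T (adjoint W (t2.tmul ξ' ξ)) (W (t2.tmul η' η)) := by
      ext ζ'
      refine ext_inner_left ℂ fun ζ => ?_
      rw [hTval, ← h12s, adjoint_inner_left, ← h23, hLt, ContinuousLinearMap.mul_apply,
        ← adjoint_inner_left, hb', ← key, ← h12]
      exact congrArg (fun X : H3 →L[ℂ] H3 => ⟪t3.tmul ξ' ξ ζ, X (t3.tmul ζ' η' η)⟫_ℂ) hpent
    rw [this]; exact hT2 _ _
  -- extend to the closed span
  have hspan1 : ∀ a ∈ slicesR t2 t2 (Sg * W), ∀ b ∈ C, a * b ∈ C := by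
    intro a ha b hb
    have hsub : Submodule.span ℂ (slicesR t2 t2 (Sg * W)) ≤
        C.comap (LinearMap.mulLeft ℂ a) := by
      rw [Submodule.span_le]; intro b hb; exact hprod a ha b hb
    have hcl : IsClosed (C.comap (LinearMap.mulLeft ℂ a) : Set (H →L[ℂ] H)) :=
      hCcl.preimage (continuous_const.mul continuous_id)
    exact Submodule.topologicalClosure_minimal _ hsub hcl hb
  intro a ha b hb
  have hsub : Submodule.span ℂ (slicesR t2 t2 (Sg * W)) ≤
      C.comap (LinearMap.mulRight ℂ b) := by
    rw [Submodule.span_le]; intro a ha; exact hspan1 a ha b hb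
  have hcl : IsClosed (C.comap (LinearMap.mulRight ℂ b) : Set (H →L[ℂ] H)) :=
    hCcl.preimage (continuous_id.mul continuous_const)
  exact Submodule.topologicalClosure_minimal _ hsub hcl ha

end
end

section
/- Let W be a semi-regular multiplicative unitary on a complex Hilbert space H, i.e. K(H) ⊆ C(W). Then [C(W)·C(W)*] ⊆ C(W) and [C(W)*·C(W)] ⊆ C(W); consequently C(W) is closed under taking adjoints, i.e. C(W) is a C*-subalgebra of B(H). -/
/-!
Common framework: we axiomatize realizations of Hilbert-space tensor products.
A `TensorPair E F EF` realizes the Hilbert tensor product `E ⊗ F` as the Hilbert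
space `EF`: it consists of a bilinear map `(a, b) ↦ a ⊗ b` whose image satisfies
the characteristic inner-product identity and has total (dense) linear span.
Operators such as the leg operators `X₁₂`, `X₂₃`, `X₁₃`, amplifications `a ⊗ b`,
and the tensor flip `Σ` are then uniquely characterized by their matrix
coefficients against elementary tensors.
-/

noncomputable section

open scoped InnerProductSpace
open ContinuousLinearMap

open scoped TensorProduct in
theorem TP_exists_emb {E F EF : Type*}
    [NormedAddCommGroup E] [InnerProductSpace ℂ E]
    [NormedAddCommGroup F] [InnerProductSpace ℂ F]
    [NormedAddCommGroup EF] [InnerProductSpace ℂ EF]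
    (t : TensorPair E F EF) :
    ∃ g : E ⊗[ℂ] F →L[ℂ] EF, (∀ a b, g (a ⊗ₜ b) = t.tmul a b) ∧ ‖g‖ ≤ 1 := by
  have hin : ∀ x y : E ⊗[ℂ] F,
      ⟪TensorProduct.lift t.tmul x, TensorProduct.lift t.tmul y⟫_ℂ = ⟪x, y⟫_ℂ := by
    intro x y
    induction x with
    | zero => simp
    | add x₁ x₂ h₁ h₂ => simp only [map_add, inner_add_left, h₁, h₂]
    | tmul a b =>
      induction y with
      | zero => simp
      | add x₁ x₂ h₁ h₂ => simp only [map_add, inner_add_right, h₁, h₂]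
      | tmul c d => simp [t.inner_tmul]
  let e : E ⊗[ℂ] F →ₗᵢ[ℂ] EF := LinearMap.isometryOfInner (TensorProduct.lift t.tmul) hin
  have he : ∀ a b, e (a ⊗ₜ b) = t.tmul a b := fun a b => by simp [e]
  refine ⟨e.toContinuousLinearMap, he, e.norm_toContinuousLinearMap_le⟩

open scoped TensorProduct in
theorem TP_exists_lift {E F EF G : Type*}
    [NormedAddCommGroup E] [InnerProductSpace ℂ E]
    [NormedAddCommGroup F] [InnerProductSpace ℂ F]
    [NormedAddCommGroup EF] [InnerProductSpace ℂ EF]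
    [NormedAddCommGroup G] [NormedSpace ℂ G] [CompleteSpace G]
    (t : TensorPair E F EF) (g : E ⊗[ℂ] F →L[ℂ] G) :
    ∃ T : EF →L[ℂ] G, (∀ a b, T (t.tmul a b) = g (a ⊗ₜ b)) ∧ ‖T‖ ≤ ‖g‖ := by
  have hin : ∀ x y : E ⊗[ℂ] F,
      ⟪TensorProduct.lift t.tmul x, TensorProduct.lift t.tmul y⟫_ℂ = ⟪x, y⟫_ℂ := by
    intro x y
    induction x with
    | zero => simp
    | add x₁ x₂ h₁ h₂ => simp only [map_add, inner_add_left, h₁, h₂]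
    | tmul a b =>
      induction y with
      | zero => simp
      | add x₁ x₂ h₁ h₂ => simp only [map_add, inner_add_right, h₁, h₂]
      | tmul c d => simp [t.inner_tmul]
  let e : E ⊗[ℂ] F →ₗᵢ[ℂ] EF := LinearMap.isometryOfInner (TensorProduct.lift t.tmul) hin
  have he : ∀ a b, e (a ⊗ₜ b) = t.tmul a b := fun a b => by simp [e]
  have hd : DenseRange e := by
    refine t.dense_span.mono ?_
    have : Submodule.span ℂ {z : EF | ∃ a b, z = t.tmul a b} ≤ LinearMap.range e.toLinearMap := by
      refine Submodule.span_le.2 ?_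
      rintro z ⟨a, b, rfl⟩
      exact ⟨a ⊗ₜ b, he a b⟩
    intro z hz
    exact this hz
  refine ⟨g.extend e.toContinuousLinearMap, fun a b => ?_, ?_⟩
  · rw [← he]
    exact ContinuousLinearMap.extend_eq g (e := e.toContinuousLinearMap) hd e.isometry.isUniformInducing _
  · have := ContinuousLinearMap.opNorm_extend_le g (e := e.toContinuousLinearMap) (N := 1) hd
      (by intro x; simp)
    simpa using this

theorem TP_ext {E F EF G : Type*}
    [NormedAddCommGroup E] [InnerProductSpace ℂ E]
    [NormedAddCommGroup F] [InnerProductSpace ℂ F]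
    [NormedAddCommGroup EF] [InnerProductSpace ℂ EF]
    [NormedAddCommGroup G] [NormedSpace ℂ G]
    (t : TensorPair E F EF) {S T : EF →L[ℂ] G}
    (h : ∀ a b, S (t.tmul a b) = T (t.tmul a b)) : S = T := by
  refine ContinuousLinearMap.ext_on t.dense_span ?_
  rintro z ⟨a, b, rfl⟩
  exact h a b

theorem TT_ext {E F G EFG K : Type*}
    [NormedAddCommGroup E] [InnerProductSpace ℂ E]
    [NormedAddCommGroup F] [InnerProductSpace ℂ F]
    [NormedAddCommGroup G] [InnerProductSpace ℂ G]
    [NormedAddCommGroup EFG] [InnerProductSpace ℂ EFG]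
    [NormedAddCommGroup K] [NormedSpace ℂ K]
    (t : TensorTriple E F G EFG) {S T : EFG →L[ℂ] K}
    (h : ∀ a b c, S (t.tmul a b c) = T (t.tmul a b c)) : S = T := by
  refine ContinuousLinearMap.ext_on t.dense_span ?_
  rintro z ⟨a, b, c, rfl⟩
  exact h a b c

theorem TP_vec_ext {E F EF : Type*}
    [NormedAddCommGroup E] [InnerProductSpace ℂ E]
    [NormedAddCommGroup F] [InnerProductSpace ℂ F]
    [NormedAddCommGroup EF] [InnerProductSpace ℂ EF] [CompleteSpace EF]
    (t : TensorPair E F EF) {x y : EF}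
    (h : ∀ a b, ⟪t.tmul a b, x⟫_ℂ = ⟪t.tmul a b, y⟫_ℂ) : x = y := by
  have : innerSL ℂ x = innerSL ℂ y := by
    refine TP_ext t fun a b => ?_
    have := congrArg (starRingEnd ℂ) (h a b)
    simpa [inner_conj_symm] using this
  exact (innerSL_inj).1 this

theorem TT_vec_ext {E F G EFG : Type*}
    [NormedAddCommGroup E] [InnerProductSpace ℂ E]
    [NormedAddCommGroup F] [InnerProductSpace ℂ F]
    [NormedAddCommGroup G] [InnerProductSpace ℂ G]
    [NormedAddCommGroup EFG] [InnerProductSpace ℂ EFG] [CompleteSpace EFG]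
    (t : TensorTriple E F G EFG) {x y : EFG}
    (h : ∀ a b c, ⟪t.tmul a b c, x⟫_ℂ = ⟪t.tmul a b c, y⟫_ℂ) : x = y := by
  have : innerSL ℂ x = innerSL ℂ y := by
    refine TT_ext t fun a b c => ?_
    have := congrArg (starRingEnd ℂ) (h a b c)
    simpa [inner_conj_symm] using this
  exact (innerSL_inj).1 this

open scoped TensorProduct in
theorem TP_exists_J {E F G EF K : Type*}
    [NormedAddCommGroup E] [InnerProductSpace ℂ E]
    [NormedAddCommGroup F] [InnerProductSpace ℂ F]
    [NormedAddCommGroup G] [InnerProductSpace ℂ G]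
    [NormedAddCommGroup EF] [InnerProductSpace ℂ EF]
    [NormedAddCommGroup K] [InnerProductSpace ℂ K] [CompleteSpace K]
    (t : TensorPair E F EF) (f : G →ₗ[ℂ] E →ₗ[ℂ] F →ₗ[ℂ] K)
    (hf : ∀ (c c' : G) (a a' : E) (b b' : F),
      ⟪f c a b, f c' a' b'⟫_ℂ = ⟪c, c'⟫_ℂ * ⟪a, a'⟫_ℂ * ⟪b, b'⟫_ℂ) :
    ∃ J : G →L[ℂ] EF →L[ℂ] K, ∀ c a b, J c (t.tmul a b) = f c a b := by
  have hin : ∀ (c : G) (x y : E ⊗[ℂ] F),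
      ⟪TensorProduct.lift (f c) x, TensorProduct.lift (f c) y⟫_ℂ = ⟪c, c⟫_ℂ * ⟪x, y⟫_ℂ := by
    intro c x y
    induction x with
    | zero => simp
    | add x₁ x₂ h₁ h₂ => simp only [map_add, inner_add_left, h₁, h₂, mul_add]
    | tmul a b =>
      induction y with
      | zero => simp
      | add x₁ x₂ h₁ h₂ => simp only [map_add, inner_add_right, h₁, h₂, mul_add]
      | tmul c d => simp [hf, mul_assoc]
  have hno : ∀ (c : G) (x : E ⊗[ℂ] F), ‖TensorProduct.lift (f c) x‖ ≤ ‖c‖ * ‖x‖ := by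
    intro c x
    have h := hin c x x
    rw [inner_self_eq_norm_sq_to_K, inner_self_eq_norm_sq_to_K,
      inner_self_eq_norm_sq_to_K (𝕜 := ℂ) x] at h
    have h' : ‖TensorProduct.lift (f c) x‖ ^ 2 = (‖c‖ * ‖x‖) ^ 2 := by
      rw [mul_pow]
      exact_mod_cast h
    exact ((sq_eq_sq₀ (norm_nonneg _) (by positivity)).1 h').le
  have hT : ∀ c : G, ∃ T : EF →L[ℂ] K, (∀ a b, T (t.tmul a b) = f c a b) ∧ ‖T‖ ≤ ‖c‖ := by
    intro c
    obtain ⟨T, h1, h2⟩ := TP_exists_lift t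
      ((TensorProduct.lift (f c)).mkContinuous ‖c‖ (hno c))
    refine ⟨T, fun a b => by rw [h1]; simp, h2.trans ?_⟩
    exact LinearMap.mkContinuous_norm_le _ (norm_nonneg _) _
  choose T h1 h2 using hT
  let J : G →ₗ[ℂ] EF →L[ℂ] K :=
    { toFun := T
      map_add' := fun c d => TP_ext t fun a b => by simp [h1]
      map_smul' := fun r c => TP_ext t fun a b => by simp [h1] }
  exact ⟨J.mkContinuous 1 (fun c => by simpa [J] using h2 c), fun c a b => h1 c a b⟩

theorem TP_exists_tmulL {E F EF : Type*}
    [NormedAddCommGroup E] [InnerProductSpace ℂ E]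
    [NormedAddCommGroup F] [InnerProductSpace ℂ F]
    [NormedAddCommGroup EF] [InnerProductSpace ℂ EF]
    (t : TensorPair E F EF) :
    ∃ L : E →L[ℂ] F →L[ℂ] EF, ∀ a b, L a b = t.tmul a b := by
  refine ⟨t.tmul.mkContinuous₂ 1 fun a b => ?_, fun a b => rfl⟩
  have h := t.inner_tmul a a b b
  simp only [inner_self_eq_norm_sq_to_K] at h
  have h' : ‖t.tmul a b‖ ^ 2 = (‖a‖ * ‖b‖) ^ 2 := by
    rw [mul_pow]
    exact_mod_cast h
  rw [one_mul]
  exact ((sq_eq_sq₀ (norm_nonneg _) (by positivity)).1 h').le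

open scoped TensorProduct in
theorem TP_exists_ampR {E F EF : Type*}
    [NormedAddCommGroup E] [InnerProductSpace ℂ E]
    [NormedAddCommGroup F] [InnerProductSpace ℂ F]
    [NormedAddCommGroup EF] [InnerProductSpace ℂ EF] [CompleteSpace EF]
    (t : TensorPair E F EF) :
    ∃ A : (F →L[ℂ] F) →L[ℂ] (EF →L[ℂ] EF), ∀ k a b, A k (t.tmul a b) = t.tmul a (k b) := by
  have hid : ∃ g : E ⊗[ℂ] F →L[ℂ] EF, (∀ a b, g (a ⊗ₜ b) = t.tmul a b) ∧ ‖g‖ ≤ 1 := by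
    exact TP_exists_emb t
  obtain ⟨g, hg, hg1⟩ := hid
  have hT : ∀ k : F →L[ℂ] F, ∃ T : EF →L[ℂ] EF,
      (∀ a b, T (t.tmul a b) = t.tmul a (k b)) ∧ ‖T‖ ≤ ‖k‖ := by
    intro k
    obtain ⟨T, h1, h2⟩ := TP_exists_lift t (g.comp (k.lTensor E))
    refine ⟨T, fun a b => by rw [h1]; simp [hg], h2.trans ?_⟩
    refine (ContinuousLinearMap.opNorm_comp_le _ _).trans ?_
    have h3 : ‖k.lTensor E‖ ≤ ‖k‖ := ContinuousLinearMap.norm_lTensor_le _ k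
    calc ‖g‖ * ‖k.lTensor E‖ ≤ 1 * ‖k‖ := by gcongr
      _ = ‖k‖ := one_mul _
  choose T h1 h2 using hT
  let J : (F →L[ℂ] F) →ₗ[ℂ] EF →L[ℂ] EF :=
    { toFun := T
      map_add' := fun c d => TP_ext t fun a b => by simp [h1]
      map_smul' := fun r c => TP_ext t fun a b => by simp [h1] }
  exact ⟨J.mkContinuous 1 (fun c => by simpa [J] using h2 c), fun c a b => h1 c a b⟩

open scoped TensorProduct in
theorem TP_exists_ampL {E F EF : Type*}
    [NormedAddCommGroup E] [InnerProductSpace ℂ E]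
    [NormedAddCommGroup F] [InnerProductSpace ℂ F]
    [NormedAddCommGroup EF] [InnerProductSpace ℂ EF] [CompleteSpace EF]
    (t : TensorPair E F EF) :
    ∃ A : (E →L[ℂ] E) →L[ℂ] (EF →L[ℂ] EF), ∀ k a b, A k (t.tmul a b) = t.tmul (k a) b := by
  have hid : ∃ g : E ⊗[ℂ] F →L[ℂ] EF, (∀ a b, g (a ⊗ₜ b) = t.tmul a b) ∧ ‖g‖ ≤ 1 := by
    exact TP_exists_emb t
  obtain ⟨g, hg, hg1⟩ := hid
  have hT : ∀ k : E →L[ℂ] E, ∃ T : EF →L[ℂ] EF,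
      (∀ a b, T (t.tmul a b) = t.tmul (k a) b) ∧ ‖T‖ ≤ ‖k‖ := by
    intro k
    obtain ⟨T, h1, h2⟩ := TP_exists_lift t (g.comp (k.rTensor F))
    refine ⟨T, fun a b => by rw [h1]; simp [hg], h2.trans ?_⟩
    refine (ContinuousLinearMap.opNorm_comp_le _ _).trans ?_
    have h3 : ‖k.rTensor F‖ ≤ ‖k‖ := ContinuousLinearMap.norm_rTensor_le _ k
    calc ‖g‖ * ‖k.rTensor F‖ ≤ 1 * ‖k‖ := by gcongr
      _ = ‖k‖ := one_mul _
  choose T h1 h2 using hT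
  let J : (E →L[ℂ] E) →ₗ[ℂ] EF →L[ℂ] EF :=
    { toFun := T
      map_add' := fun c d => TP_ext t fun a b => by simp [h1]
      map_smul' := fun r c => TP_ext t fun a b => by simp [h1] }
  exact ⟨J.mkContinuous 1 (fun c => by simpa [J] using h2 c), fun c a b => h1 c a b⟩

theorem star_mem_of_mul_star {A : Type*} [CStarAlgebra A] (V : Submodule ℂ A)
    (hV : IsClosed (V : Set A)) (h1 : ∀ a ∈ V, ∀ b ∈ V, a * star b ∈ V)
    (h2 : ∀ a ∈ V, ∀ b ∈ V, star a * b ∈ V) (c : A) (hc : c ∈ V) : star c ∈ V := by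
  rcases subsingleton_or_nontrivial A with hA | hA
  · rw [Subsingleton.elim (star c) c]; exact hc
  set a : A := c * star c with ha
  have haV : a ∈ V := h1 c hc c hc
  have hsa : IsSelfAdjoint a := IsSelfAdjoint.mul_star_self c
  set s : ℝ := (‖a‖ + 1)⁻¹ with hs
  have hs0 : 0 < s := by positivity
  have hy : ∀ n : ℕ, (1 - (s : ℂ) • a) ^ n * c ∈ V ∧ star (c - (1 - (s : ℂ) • a) ^ n * c) ∈ V := by
    intro n
    induction n with
    | zero => simp [hc]
    | succ n ih =>
      obtain ⟨ih1, ih2⟩ := ih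
      set y := (1 - (s : ℂ) • a) ^ n * c with hyy
      have e : (1 - (s : ℂ) • a) ^ (n + 1) * c = y - (s : ℂ) • (a * y) := by
        rw [pow_succ', mul_assoc, ← hyy, sub_mul, one_mul, smul_mul_assoc]
      rw [e]
      have h3 : a * y ∈ V := by
        have := h2 a haV y ih1
        rwa [hsa.star_eq] at this
      have h4 : star (a * y) ∈ V := by
        rw [star_mul]
        exact h2 y ih1 _ (by rwa [hsa.star_eq])
      refine ⟨V.sub_mem ih1 (V.smul_mem _ h3), ?_⟩
      have : c - (y - (s : ℂ) • (a * y)) = (c - y) + (s : ℂ) • (a * y) := by abel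
      rw [this, star_add, star_smul]
      exact V.add_mem ih2 (V.smul_mem _ h4)
  have hb : ∀ n : ℕ, ‖(1 - (s : ℂ) • a) ^ n * c‖ ^ 2 ≤ s⁻¹ * (1 / ((n : ℝ) + 1)) := by
    intro n
    have e1 : ‖(1 - (s : ℂ) • a) ^ n * c‖ ^ 2
        = ‖(1 - (s : ℂ) • a) ^ n * a * (1 - (s : ℂ) • a) ^ n‖ := by
      rw [sq, ← CStarRing.norm_self_mul_star, star_mul, star_pow, star_sub, star_one, star_smul,
        hsa.star_eq]
      simp [ha, mul_assoc]
    have e2 : (1 - (s : ℂ) • a) ^ n * a * (1 - (s : ℂ) • a) ^ n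
        = cfc (fun x : ℝ => (1 - s * x) ^ n * x * (1 - s * x) ^ n) a := by
      rw [cfc_mul _ _ a, cfc_mul _ _ a, cfc_pow _ _ a, cfc_sub _ _ a, cfc_const_mul _ _ a, cfc_id' ℝ a, cfc_const_one ℝ a]
      simp
    rw [e1, e2]
    refine norm_cfc_le (by positivity) fun x hx => ?_
    have hx0 : 0 ≤ x := spectrum_star_mul_self_nonneg (b := star c) x (by simpa using hx)
    have hx1 : x ≤ ‖a‖ := by
      have := spectrum.norm_le_norm_of_mem hx
      exact (le_abs_self x).trans this
    have hu0 : 0 ≤ s * x := by positivity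
    have hu1 : s * x ≤ 1 := by
      rw [hs, inv_mul_le_iff₀ (by positivity)]; linarith
    have hq0 : 0 ≤ (1 - s * x) ^ n := pow_nonneg (by linarith) _
    have hq1 : (1 - s * x) ^ n ≤ 1 := pow_le_one₀ (by linarith) (by linarith)
    have key : ∀ (u : ℝ), 0 ≤ u → u ≤ 1 → (1 - u) ^ n * u ≤ 1 / ((n : ℝ) + 1) := by
      intro u h0 h1
      rw [le_div_iff₀ (by positivity)]
      have hB := one_add_mul_le_pow (a := u) (by linarith) n
      have h3 : (1 - u) ^ n * (1 + u) ^ n ≤ 1 := by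
        rw [← mul_pow]; exact pow_le_one₀ (by nlinarith) (by nlinarith)
      have h4 : 0 ≤ (1 - u) ^ n := pow_nonneg (by linarith) _
      have h5 : (1 - u) ^ n * (1 + n * u) ≤ 1 := (mul_le_mul_of_nonneg_left hB h4).trans h3
      nlinarith
    have hk := key (s * x) hu0 hu1
    rw [Real.norm_of_nonneg (by positivity)]
    have h6 : (1 - s * x) ^ n * x ≤ s⁻¹ * (1 / ((n : ℝ) + 1)) := by
      rw [le_inv_mul_iff₀ hs0]; linarith
    have h7 : 0 ≤ (1 - s * x) ^ n * x := by positivity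
    nlinarith
  have hlim : Filter.Tendsto (fun n : ℕ => (1 - (s : ℂ) • a) ^ n * c) Filter.atTop (nhds 0) := by
    have hl : Filter.Tendsto (fun n : ℕ => ‖(1 - (s : ℂ) • a) ^ n * c‖ ^ 2) Filter.atTop (nhds 0) := by
      refine squeeze_zero (fun n => by positivity) hb ?_
      simpa using tendsto_one_div_add_atTop_nhds_zero_nat.const_mul s⁻¹
    rw [tendsto_zero_iff_norm_tendsto_zero]
    have h8 := hl.sqrt
    rw [Real.sqrt_zero] at h8
    exact h8.congr fun n => Real.sqrt_sq (norm_nonneg _)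
  have hlim2 : Filter.Tendsto (fun n : ℕ => star (c - (1 - (s : ℂ) • a) ^ n * c)) Filter.atTop
      (nhds (star c)) := by
    have h9 := (hlim.const_sub c).star
    rwa [sub_zero] at h9
  exact hV.mem_of_tendsto hlim2 (Filter.Eventually.of_forall fun n => (hy n).2)

section MU

set_option linter.unusedSectionVars false

variable {H H2 H3 : Type*}
    [NormedAddCommGroup H] [InnerProductSpace ℂ H] [CompleteSpace H]
    [NormedAddCommGroup H2] [InnerProductSpace ℂ H2] [CompleteSpace H2]
    [NormedAddCommGroup H3] [InnerProductSpace ℂ H3] [CompleteSpace H3]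

theorem leg12_J (t2 : TensorPair H H H2) (t3 : TensorTriple H H H H3)
    (J : H →L[ℂ] H2 →L[ℂ] H3) (hJ : ∀ a b c, J c (t2.tmul a b) = t3.tmul a b c)
    (X : H2 →L[ℂ] H2) (Y : H3 →L[ℂ] H3) (h : IsLeg12 t2 t3 X Y) (c : H) (x : H2) :
    Y (J c x) = J c (X x) := by
  have hin : ∀ a b c' x, ⟪t3.tmul a b c', J c x⟫_ℂ = ⟪t2.tmul a b, x⟫_ℂ * ⟪c', c⟫_ℂ := by
    intro a b c' x
    have : (innerSL ℂ (t3.tmul a b c')).comp (J c) = ⟪c', c⟫_ℂ • innerSL ℂ (t2.tmul a b) :=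
      TP_ext t2 fun a' b' => by
        simp [hJ, t3.inner_tmul, t2.inner_tmul]; ring
    have := DFunLike.congr_fun this x
    simp at this
    rw [this]; ring
  have : Y.comp (J c) = (J c).comp X := by
    refine TP_ext t2 fun a' b' => TT_vec_ext t3 fun a b c' => ?_
    simp only [ContinuousLinearMap.comp_apply]
    rw [hin, hJ, h]
  exact DFunLike.congr_fun this x

theorem leg13_J (t2 : TensorPair H H H2) (t3 : TensorTriple H H H H3)
    (J : H →L[ℂ] H2 →L[ℂ] H3) (hJ : ∀ a b c, J b (t2.tmul a c) = t3.tmul a b c)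
    (X : H2 →L[ℂ] H2) (Y : H3 →L[ℂ] H3) (h : IsLeg13 t2 t3 X Y) (c : H) (x : H2) :
    Y (J c x) = J c (X x) := by
  have hin : ∀ a b c' x, ⟪t3.tmul a c' b, J c x⟫_ℂ = ⟪t2.tmul a b, x⟫_ℂ * ⟪c', c⟫_ℂ := by
    intro a b c' x
    have : (innerSL ℂ (t3.tmul a c' b)).comp (J c) = ⟪c', c⟫_ℂ • innerSL ℂ (t2.tmul a b) :=
      TP_ext t2 fun a' b' => by
        simp [hJ, t3.inner_tmul, t2.inner_tmul]; ring
    have := DFunLike.congr_fun this x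
    simp at this
    rw [this]; ring
  have : Y.comp (J c) = (J c).comp X := by
    refine TP_ext t2 fun a' b' => TT_vec_ext t3 fun a b c' => ?_
    simp only [ContinuousLinearMap.comp_apply]
    rw [hin, hJ, h]
  exact DFunLike.congr_fun this x

theorem leg23_J (t2 : TensorPair H H H2) (t3 : TensorTriple H H H H3)
    (J : H →L[ℂ] H2 →L[ℂ] H3) (hJ : ∀ a b c, J a (t2.tmul b c) = t3.tmul a b c)
    (X : H2 →L[ℂ] H2) (Y : H3 →L[ℂ] H3) (h : IsLeg23 t2 t3 X Y) (c : H) (x : H2) :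
    Y (J c x) = J c (X x) := by
  have hin : ∀ a b c' x, ⟪t3.tmul c' a b, J c x⟫_ℂ = ⟪t2.tmul a b, x⟫_ℂ * ⟪c', c⟫_ℂ := by
    intro a b c' x
    have : (innerSL ℂ (t3.tmul c' a b)).comp (J c) = ⟪c', c⟫_ℂ • innerSL ℂ (t2.tmul a b) :=
      TP_ext t2 fun a' b' => by
        simp [hJ, t3.inner_tmul, t2.inner_tmul]; ring
    have := DFunLike.congr_fun this x
    simp at this
    rw [this]; ring
  have : Y.comp (J c) = (J c).comp X := by
    refine TP_ext t2 fun a' b' => TT_vec_ext t3 fun a b c' => ?_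
    simp only [ContinuousLinearMap.comp_apply]
    rw [hin, hJ, h]
  exact DFunLike.congr_fun this x

theorem inner_star_apply {E : Type*} [NormedAddCommGroup E] [InnerProductSpace ℂ E]
    [CompleteSpace E] (T : E →L[ℂ] E) (x y : E) :
    ⟪x, star T y⟫_ℂ = starRingEnd ℂ ⟪y, T x⟫_ℂ := by
  rw [ContinuousLinearMap.star_eq_adjoint, ContinuousLinearMap.adjoint_inner_right,
    inner_conj_symm]

theorem IsLeg12.star' {t2 : TensorPair H H H2} {t3 : TensorTriple H H H H3}
    {X : H2 →L[ℂ] H2} {Y : H3 →L[ℂ] H3} (h : IsLeg12 t2 t3 X Y) :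
    IsLeg12 t2 t3 (star X) (star Y) := by
  intro a a' b b' c c'
  rw [inner_star_apply, inner_star_apply, h, map_mul, inner_conj_symm c]

theorem IsLeg13.star' {t2 : TensorPair H H H2} {t3 : TensorTriple H H H H3}
    {X : H2 →L[ℂ] H2} {Y : H3 →L[ℂ] H3} (h : IsLeg13 t2 t3 X Y) :
    IsLeg13 t2 t3 (star X) (star Y) := by
  intro a a' b b' c c'
  rw [inner_star_apply, inner_star_apply, h, map_mul, inner_conj_symm b]

theorem IsLeg23.star' {t2 : TensorPair H H H2} {t3 : TensorTriple H H H H3}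
    {X : H2 →L[ℂ] H2} {Y : H3 →L[ℂ] H3} (h : IsLeg23 t2 t3 X Y) :
    IsLeg23 t2 t3 (star X) (star Y) := by
  intro a a' b b' c c'
  rw [inner_star_apply, inner_star_apply, h, map_mul, inner_conj_symm a]

/-- elementary slices -/
def sl0 (t2 : TensorPair H H H2) (W : H2 →L[ℂ] H2) : Set (H →L[ℂ] H) :=
  {T | ∃ ξ η : H, ∀ ζ ζ' : H, ⟪ζ, T ζ'⟫_ℂ = ⟪t2.tmul ξ ζ, W (t2.tmul ζ' η)⟫_ℂ}

theorem mem_of_dense (t2 : TensorPair H H H2) {B : Type*} [NormedAddCommGroup B] [NormedSpace ℂ B]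
    (V : Submodule ℂ B) (hV : IsClosed (V : Set B)) {σ : ℂ →+* ℂ} (Φ : H2 →ₛₗ[σ] B)
    (hc : Continuous Φ) (h : ∀ a b, Φ (t2.tmul a b) ∈ V) (x : H2) : Φ x ∈ V := by
  have hcl : IsClosed {x | Φ x ∈ V} := hV.preimage hc
  have : closure (Submodule.span ℂ {z : H2 | ∃ a b, z = t2.tmul a b} : Set H2) ⊆ {x | Φ x ∈ V} := by
    refine closure_minimal ?_ hcl
    have : Submodule.span ℂ {z : H2 | ∃ a b, z = t2.tmul a b} ≤ V.comap Φ := by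
      refine Submodule.span_le.2 ?_
      rintro z ⟨a, b, rfl⟩
      exact h a b
    exact this
  exact this (t2.dense_span x)

theorem map_mem_of_span {B : Type*} [NormedAddCommGroup B] [NormedSpace ℂ B] (S : Set B)
    (V : Submodule ℂ B) (hV : IsClosed (V : Set B)) {σ : ℂ →+* ℂ} (Φ : B →ₛₗ[σ] B)
    (hc : Continuous Φ) (h : ∀ a ∈ S, Φ a ∈ V) (x : B)
    (hx : x ∈ (Submodule.span ℂ S).topologicalClosure) : Φ x ∈ V := by
  have hcl : IsClosed ((V.comap Φ : Submodule ℂ B) : Set B) := hV.preimage hc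
  exact (Submodule.topologicalClosure_minimal _ (Submodule.span_le.2 (fun a ha => h a ha)) hcl) hx

theorem part1 (t2 : TensorPair H H H2) (t3 : TensorTriple H H H H3)
    (W : H2 →L[ℂ] H2) (W12 W23 W13 : H3 →L[ℂ] H3)
    (hW12 : IsLeg12 t2 t3 W W12) (hW23 : IsLeg23 t2 t3 W W23)
    (hpent : W13 * W23 * star W12 = star W12 * W23)
    (L : H →L[ℂ] H →L[ℂ] H2) (hL : ∀ a b, L a b = t2.tmul a b)
    (J2 J3 : H →L[ℂ] H2 →L[ℂ] H3)
    (hJ2 : ∀ a b c, J2 b (t2.tmul a c) = t3.tmul a b c)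
    (hJ3 : ∀ a b c, J3 c (t2.tmul a b) = t3.tmul a b c)
    (h13 : ∀ c x, star W13 (J2 c x) = J2 c (star W x))
    (V : Submodule ℂ (H →L[ℂ] H)) (hVd : V = (Submodule.span ℂ (sl0 t2 W)).topologicalClosure)
    (hsemi : ∀ T : H →L[ℂ] H, IsCompactOperator T → T ∈ V)
    (a b : H →L[ℂ] H) (ha : a ∈ sl0 t2 W) (hb : b ∈ sl0 t2 W) : a * star b ∈ V := by
  have hVc : IsClosed (V : Set (H →L[ℂ] H)) := hVd ▸ Submodule.isClosed_topologicalClosure _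
  have hsub : ∀ T ∈ sl0 t2 W, T ∈ V := fun T hT =>
    hVd ▸ Submodule.le_topologicalClosure _ (Submodule.subset_span hT)
  obtain ⟨ξ, η, ha⟩ := ha
  obtain ⟨ξ', η', hb⟩ := hb
  obtain ⟨A, hA⟩ := TP_exists_ampR t2
  -- the slice map
  let P : (H →L[ℂ] H) →ₗ[ℂ] (H →L[ℂ] H) :=
    { toFun := fun k => (adjoint (L ξ)).comp (W.comp ((A k).comp ((star W).comp (L ξ'))))
      map_add' := fun k l => by ext; simp
      map_smul' := fun r k => by ext; simp }
  have hPdef : ∀ k, P k = (adjoint (L ξ)).comp (W.comp ((A k).comp ((star W).comp (L ξ')))) :=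
    fun _ => rfl
  have hPc : Continuous P := by
    show Continuous fun k => (adjoint (L ξ)).comp (W.comp ((A k).comp ((star W).comp (L ξ'))))
    fun_prop
  have hPin : ∀ k ζ ζ', ⟪ζ, P k ζ'⟫_ℂ = ⟪t2.tmul ξ ζ, W (A k (star W (t2.tmul ξ' ζ')))⟫_ℂ := by
    intro k ζ ζ'
    rw [hPdef]
    simp only [ContinuousLinearMap.comp_apply]
    rw [ContinuousLinearMap.adjoint_inner_right, hL, hL]
  have hPV : ∀ k ∈ V, P k ∈ V := by
    intro k hk
    rw [hVd] at hk
    refine map_mem_of_span _ V hVc P hPc ?_ k hk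
    rintro S ⟨α, β, hS⟩
    have hAS : A S = (adjoint (J2 α)).comp (W23.comp (J3 β)) := by
      refine TP_ext t2 fun c d => TP_vec_ext t2 fun c' d' => ?_
      rw [hA, t2.inner_tmul]
      simp only [ContinuousLinearMap.comp_apply]
      rw [ContinuousLinearMap.adjoint_inner_right, hJ2, hJ3, hW23, hS]
      ring
    let Φ : H2 →ₛₗ[starRingEnd ℂ] (H →L[ℂ] H) :=
      { toFun := fun x => (adjoint (J3.flip x)).comp (W23.comp ((J3 β).comp (L ξ')))
        map_add' := fun k l => by ext; simp
        map_smul' := fun r k => by ext; simp [map_smulₛₗ] }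
    have hΦdef : ∀ x, Φ x = (adjoint (J3.flip x)).comp (W23.comp ((J3 β).comp (L ξ'))) :=
      fun _ => rfl
    have hΦc : Continuous Φ := by
      show Continuous fun x => (adjoint (J3.flip x)).comp (W23.comp ((J3 β).comp (L ξ')))
      have : Continuous fun x => adjoint (J3.flip x) :=
        (adjoint (𝕜 := ℂ) (E := H) (F := H3)).continuous.comp J3.flip.continuous
      fun_prop
    have hΦin : ∀ x ζ ζ', ⟪ζ, Φ x ζ'⟫_ℂ = ⟪J3 ζ x, W23 (t3.tmul ξ' ζ' β)⟫_ℂ := by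
      intro x ζ ζ'
      rw [hΦdef]
      simp only [ContinuousLinearMap.comp_apply]
      rw [ContinuousLinearMap.adjoint_inner_right, hL, hJ3, ContinuousLinearMap.flip_apply]
    have hPS : P S = Φ (W (t2.tmul ξ α)) := by
      refine ContinuousLinearMap.ext fun ζ' => ext_inner_left ℂ fun ζ => ?_
      rw [hPin, hΦin, hAS, ← leg12_J t2 t3 J3 hJ3 W W12 hW12, hJ3]
      simp only [ContinuousLinearMap.comp_apply]
      have e1 : J3 β (star W (t2.tmul ξ' ζ')) = star W12 (t3.tmul ξ' ζ' β) := by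
        rw [← leg12_J t2 t3 J3 hJ3 _ _ hW12.star', hJ3]
      have e2 : J2 α (star W (t2.tmul ξ ζ)) = star W13 (t3.tmul ξ α ζ) := by
        rw [← h13, hJ2]
      have e3 := DFunLike.congr_fun hpent (t3.tmul ξ' ζ' β)
      simp only [mul_apply_eq_comp] at e3
      rw [← ContinuousLinearMap.adjoint_inner_left W, ContinuousLinearMap.adjoint_inner_right,
        ← ContinuousLinearMap.star_eq_adjoint, e1, e2, ContinuousLinearMap.star_eq_adjoint,
        ContinuousLinearMap.adjoint_inner_left, e3, ContinuousLinearMap.star_eq_adjoint,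
        ContinuousLinearMap.adjoint_inner_right]
    rw [hPS]
    refine mem_of_dense t2 V hVc Φ hΦc (fun c d => ?_) _
    -- `Φ (c ⊗ d)` is a multiple of a slice
    refine hsub _ ⟨d, ⟪c, ξ'⟫_ℂ • β, fun ζ ζ' => ?_⟩
    rw [hΦin, hJ3, hW23, map_smul, map_smul, inner_smul_right]
    ring
  -- identify `a * star b`
  let K : H →L[ℂ] H := (innerSL ℂ η').smulRight η
  have hK : ∀ x, K x = ⟪η', x⟫_ℂ • η := fun x => by simp [K]
  have hKV : K ∈ V := by
    refine hsemi _ ?_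
    have h0 : IsCompactOperator (id : ℂ → ℂ) := isCompactOperator_id
    have h1 := (h0.comp_clm (innerSL ℂ η')).clm_comp (ContinuousLinearMap.toSpanSingleton ℂ η)
    exact h1
  have hAK : A K = ((L.flip η)).comp (adjoint (L.flip η')) := by
    refine TP_ext t2 fun c d => TP_vec_ext t2 fun c' d' => ?_
    have hk : adjoint (L.flip η') (t2.tmul c d) = ⟪η', d⟫_ℂ • c := by
      refine ext_inner_left ℂ fun v => ?_
      rw [ContinuousLinearMap.adjoint_inner_right, ContinuousLinearMap.flip_apply, hL,
        t2.inner_tmul, inner_smul_right]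
      ring
    rw [hA, ContinuousLinearMap.comp_apply, hk, ContinuousLinearMap.flip_apply, hL, hK]
    simp
  have ha' : a = (adjoint (L ξ)).comp (W.comp (L.flip η)) := by
    refine ContinuousLinearMap.ext fun ζ' => ext_inner_left ℂ fun ζ => ?_
    simp only [ContinuousLinearMap.comp_apply]
    rw [ha, ContinuousLinearMap.adjoint_inner_right, ContinuousLinearMap.flip_apply, hL, hL]
  have hb' : b = (adjoint (L ξ')).comp (W.comp (L.flip η')) := by
    refine ContinuousLinearMap.ext fun ζ' => ext_inner_left ℂ fun ζ => ?_
    simp only [ContinuousLinearMap.comp_apply]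
    rw [hb, ContinuousLinearMap.adjoint_inner_right, ContinuousLinearMap.flip_apply, hL, hL]
  have : a * star b = P K := by
    rw [hPdef, hAK, ha', hb', ContinuousLinearMap.star_eq_adjoint,
      ContinuousLinearMap.star_eq_adjoint,
      ContinuousLinearMap.adjoint_comp, ContinuousLinearMap.adjoint_comp,
      ContinuousLinearMap.adjoint_adjoint]
    rfl
  rw [this]
  exact hPV K hKV

theorem part2 (t2 : TensorPair H H H2) (t3 : TensorTriple H H H H3)
    (W : H2 →L[ℂ] H2) (W12 W23 W13 : H3 →L[ℂ] H3)
    (hW12 : IsLeg12 t2 t3 W W12) (hW23 : IsLeg23 t2 t3 W W23) (hW13 : IsLeg13 t2 t3 W W13)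
    (hpent : star W23 * W12 * W13 = W12 * star W23)
    (L : H →L[ℂ] H →L[ℂ] H2) (hL : ∀ a b, L a b = t2.tmul a b)
    (J1 J2 : H →L[ℂ] H2 →L[ℂ] H3)
    (hJ1 : ∀ a b c, J1 a (t2.tmul b c) = t3.tmul a b c)
    (hJ2 : ∀ a b c, J2 b (t2.tmul a c) = t3.tmul a b c)
    (V : Submodule ℂ (H →L[ℂ] H)) (hVd : V = (Submodule.span ℂ (sl0 t2 W)).topologicalClosure)
    (hsemi : ∀ T : H →L[ℂ] H, IsCompactOperator T → T ∈ V)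
    (a b : H →L[ℂ] H) (ha : a ∈ sl0 t2 W) (hb : b ∈ sl0 t2 W) : star a * b ∈ V := by
  have hVc : IsClosed (V : Set (H →L[ℂ] H)) := hVd ▸ Submodule.isClosed_topologicalClosure _
  have hsub : ∀ T ∈ sl0 t2 W, T ∈ V := fun T hT =>
    hVd ▸ Submodule.le_topologicalClosure _ (Submodule.subset_span hT)
  obtain ⟨ξ, η, ha⟩ := ha
  obtain ⟨ξ', η', hb⟩ := hb
  obtain ⟨A, hA⟩ := TP_exists_ampL t2
  let P : (H →L[ℂ] H) →ₗ[ℂ] (H →L[ℂ] H) :=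
    { toFun := fun k => (adjoint (L.flip η)).comp ((star W).comp ((A k).comp (W.comp (L.flip η'))))
      map_add' := fun k l => by ext; simp
      map_smul' := fun r k => by ext; simp }
  have hPdef : ∀ k, P k =
      (adjoint (L.flip η)).comp ((star W).comp ((A k).comp (W.comp (L.flip η')))) :=
    fun _ => rfl
  have hPc : Continuous P := by
    show Continuous fun k =>
      (adjoint (L.flip η)).comp ((star W).comp ((A k).comp (W.comp (L.flip η'))))
    fun_prop
  have hPin : ∀ k ζ ζ', ⟪ζ, P k ζ'⟫_ℂ = ⟪t2.tmul ζ η, star W (A k (W (t2.tmul ζ' η')))⟫_ℂ := by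
    intro k ζ ζ'
    rw [hPdef]
    simp only [ContinuousLinearMap.comp_apply]
    rw [ContinuousLinearMap.adjoint_inner_right, ContinuousLinearMap.flip_apply,
      ContinuousLinearMap.flip_apply, hL, hL]
  have hPV : ∀ k ∈ V, P k ∈ V := by
    intro k hk
    rw [hVd] at hk
    refine map_mem_of_span _ V hVc P hPc ?_ k hk
    rintro S ⟨α, β, hS⟩
    have hAS : A S = (adjoint (J1 α)).comp (W12.comp (J2 β)) := by
      refine TP_ext t2 fun c d => TP_vec_ext t2 fun c' d' => ?_
      rw [hA, t2.inner_tmul]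
      simp only [ContinuousLinearMap.comp_apply]
      rw [ContinuousLinearMap.adjoint_inner_right, hJ1, hJ2, hW12, hS]
    let Φ : H2 →ₛₗ[RingHom.id ℂ] (H →L[ℂ] H) :=
      { toFun := fun x =>
          (adjoint (L.flip η)).comp ((adjoint (J1 α)).comp (W12.comp (J1.flip x)))
        map_add' := fun k l => by ext; simp
        map_smul' := fun r k => by ext; simp }
    have hΦdef : ∀ x, Φ x =
        (adjoint (L.flip η)).comp ((adjoint (J1 α)).comp (W12.comp (J1.flip x))) :=
      fun _ => rfl
    have hΦc : Continuous Φ := by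
      show Continuous fun x =>
        (adjoint (L.flip η)).comp ((adjoint (J1 α)).comp (W12.comp (J1.flip x)))
      fun_prop
    have hΦin : ∀ x ζ ζ', ⟪ζ, Φ x ζ'⟫_ℂ = ⟪t3.tmul α ζ η, W12 (J1 ζ' x)⟫_ℂ := by
      intro x ζ ζ'
      rw [hΦdef]
      simp only [ContinuousLinearMap.comp_apply]
      rw [ContinuousLinearMap.adjoint_inner_right, ContinuousLinearMap.adjoint_inner_right,
        ContinuousLinearMap.flip_apply, ContinuousLinearMap.flip_apply, hL, hJ1]
    have hPS : P S = Φ (star W (t2.tmul β η')) := by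
      refine ContinuousLinearMap.ext fun ζ' => ext_inner_left ℂ fun ζ => ?_
      rw [hPin, hΦin, hAS, ← leg23_J t2 t3 J1 hJ1 _ _ hW23.star', hJ1]
      simp only [ContinuousLinearMap.comp_apply]
      have e1 : J2 β (W (t2.tmul ζ' η')) = W13 (t3.tmul ζ' β η') := by
        rw [← leg13_J t2 t3 J2 hJ2 _ _ hW13, hJ2]
      have e2 : J1 α (W (t2.tmul ζ η)) = W23 (t3.tmul α ζ η) := by
        rw [← leg23_J t2 t3 J1 hJ1 _ _ hW23, hJ1]
      have e3 := DFunLike.congr_fun hpent (t3.tmul ζ' β η')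
      simp only [mul_apply_eq_comp] at e3
      rw [← e3, ContinuousLinearMap.star_eq_adjoint, ContinuousLinearMap.star_eq_adjoint,
        ContinuousLinearMap.adjoint_inner_right, ContinuousLinearMap.adjoint_inner_right,
        ContinuousLinearMap.adjoint_inner_right, e1, e2]
    rw [hPS]
    refine mem_of_dense t2 V hVc Φ hΦc (fun c d => ?_) _
    refine hsub _ ⟨α, ⟪η, d⟫_ℂ • c, fun ζ ζ' => ?_⟩
    rw [hΦin, hJ1, hW12, map_smul, map_smul, inner_smul_right]
    ring
  let K : H →L[ℂ] H := (innerSL ℂ ξ').smulRight ξ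
  have hK : ∀ x, K x = ⟪ξ', x⟫_ℂ • ξ := fun x => by simp [K]
  have hKV : K ∈ V := by
    refine hsemi _ ?_
    have h0 : IsCompactOperator (id : ℂ → ℂ) := isCompactOperator_id
    have h1 := (h0.comp_clm (innerSL ℂ ξ')).clm_comp (ContinuousLinearMap.toSpanSingleton ℂ ξ)
    exact h1
  have hAK : A K = (L ξ).comp (adjoint (L ξ')) := by
    refine TP_ext t2 fun c d => TP_vec_ext t2 fun c' d' => ?_
    have hk : adjoint (L ξ') (t2.tmul c d) = ⟪ξ', c⟫_ℂ • d := by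
      refine ext_inner_left ℂ fun v => ?_
      rw [ContinuousLinearMap.adjoint_inner_right, hL, t2.inner_tmul, inner_smul_right]
    rw [hA, ContinuousLinearMap.comp_apply, hk, hL, hK]
    simp
  have ha' : a = (adjoint (L ξ)).comp (W.comp (L.flip η)) := by
    refine ContinuousLinearMap.ext fun ζ' => ext_inner_left ℂ fun ζ => ?_
    simp only [ContinuousLinearMap.comp_apply]
    rw [ha, ContinuousLinearMap.adjoint_inner_right, ContinuousLinearMap.flip_apply, hL, hL]
  have hb' : b = (adjoint (L ξ')).comp (W.comp (L.flip η')) := by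
    refine ContinuousLinearMap.ext fun ζ' => ext_inner_left ℂ fun ζ => ?_
    simp only [ContinuousLinearMap.comp_apply]
    rw [hb, ContinuousLinearMap.adjoint_inner_right, ContinuousLinearMap.flip_apply, hL, hL]
  have : star a * b = P K := by
    rw [hPdef, hAK, ha', hb', ContinuousLinearMap.star_eq_adjoint,
      ContinuousLinearMap.star_eq_adjoint,
      ContinuousLinearMap.adjoint_comp, ContinuousLinearMap.adjoint_comp,
      ContinuousLinearMap.adjoint_adjoint]
    rfl
  rw [this]
  exact hPV K hKV

end MU
/-- If `W` is a semi-regular multiplicative unitary on `H`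
(`K(H) ⊆ C(W)`), then `[C(W)·C(W)*] ⊆ C(W)`, `[C(W)*·C(W)] ⊆ C(W)`, and
`C(W)* = C(W)`; so `C(W)` is a C*-subalgebra of `B(H)`. -/
theorem statement3
    {H H2 H3 : Type*}
    [NormedAddCommGroup H] [InnerProductSpace ℂ H] [CompleteSpace H]
    [NormedAddCommGroup H2] [InnerProductSpace ℂ H2] [CompleteSpace H2]
    [NormedAddCommGroup H3] [InnerProductSpace ℂ H3] [CompleteSpace H3]
    -- realizations of the tensor products H ⊗ H and H ⊗ H ⊗ H
    (t2 : TensorPair H H H2) (t3 : TensorTriple H H H H3)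
    -- W is a unitary on H ⊗ H
    (W : H2 →L[ℂ] H2) (hWu : star W * W = 1 ∧ W * star W = 1)
    -- the legs W₁₂, W₂₃, W₁₃ of W on H ⊗ H ⊗ H
    (W12 W23 W13 : H3 →L[ℂ] H3)
    (hW12 : IsLeg12 t2 t3 W W12) (hW23 : IsLeg23 t2 t3 W W23)
    (hW13 : IsLeg13 t2 t3 W W13)
    -- the pentagon equation W₂₃W₁₂ = W₁₂W₁₃W₂₃
    (hpent : W23 * W12 = W12 * W13 * W23)
    -- the tensor flip Σ on H ⊗ H
    (Sg : H2 →L[ℂ] H2) (hSg : ∀ a b : H, Sg (t2.tmul a b) = t2.tmul b a)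
    -- semi-regularity: K(H) ⊆ C(W)
    (hsemi : {T : H →L[ℂ] H | IsCompactOperator T} ⊆ hatA t2 (Sg * W)) :
    cspan {x : H →L[ℂ] H | ∃ a ∈ hatA t2 (Sg * W), ∃ b ∈ hatA t2 (Sg * W),
        x = a * star b} ⊆ hatA t2 (Sg * W) ∧
    cspan {x : H →L[ℂ] H | ∃ a ∈ hatA t2 (Sg * W), ∃ b ∈ hatA t2 (Sg * W),
        x = star a * b} ⊆ hatA t2 (Sg * W) ∧
    star '' hatA t2 (Sg * W) = hatA t2 (Sg * W) := by
  obtain ⟨L, hL⟩ := TP_exists_tmulL t2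
  obtain ⟨J1, hJ1⟩ := TP_exists_J t2 t3.tmul
    (fun c c' a a' b b' => t3.inner_tmul c c' a a' b b')
  obtain ⟨J2, hJ2⟩ := TP_exists_J t2 t3.tmul.flip
    (fun c c' a a' b b' => by
      simp only [LinearMap.flip_apply]; rw [t3.inner_tmul]; ring)
  obtain ⟨J3, hJ3⟩ := TP_exists_J t2
    (LinearMap.flip ((LinearMap.lflip (R₀ := ℂ) (σ₁₂ := RingHom.id ℂ)).comp t3.tmul))
    (fun c c' a a' b b' => by
      refine (t3.inner_tmul a a' b b' c c').trans ?_
      ring)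
  have hJ1' : ∀ a b c, J1 a (t2.tmul b c) = t3.tmul a b c := fun a b c => hJ1 a b c
  have hJ2' : ∀ a b c, J2 b (t2.tmul a c) = t3.tmul a b c := fun a b c => hJ2 b a c
  have hJ3' : ∀ a b c, J3 c (t2.tmul a b) = t3.tmul a b c := fun a b c => hJ3 c a b
  have hu : ∀ x, star W (W x) = x := fun x => DFunLike.congr_fun hWu.1 x
  have hu' : ∀ x, W (star W x) = x := fun x => DFunLike.congr_fun hWu.2 x
  have u12 : star W12 * W12 = 1 := TT_ext t3 fun a b c => by
    rw [← hJ3', mul_apply_eq_comp, leg12_J t2 t3 J3 hJ3' _ _ hW12,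
      leg12_J t2 t3 J3 hJ3' _ _ hW12.star', hu]; rfl
  have u12' : W12 * star W12 = 1 := TT_ext t3 fun a b c => by
    rw [← hJ3', mul_apply_eq_comp, leg12_J t2 t3 J3 hJ3' _ _ hW12.star',
      leg12_J t2 t3 J3 hJ3' _ _ hW12, hu']; rfl
  have u23 : star W23 * W23 = 1 := TT_ext t3 fun a b c => by
    rw [← hJ1', mul_apply_eq_comp, leg23_J t2 t3 J1 hJ1' _ _ hW23,
      leg23_J t2 t3 J1 hJ1' _ _ hW23.star', hu]; rfl
  have u23' : W23 * star W23 = 1 := TT_ext t3 fun a b c => by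
    rw [← hJ1', mul_apply_eq_comp, leg23_J t2 t3 J1 hJ1' _ _ hW23.star',
      leg23_J t2 t3 J1 hJ1' _ _ hW23, hu']; rfl
  have p1 : W13 * W23 * star W12 = star W12 * W23 := by
    calc W13 * W23 * star W12 = (star W12 * W12) * W13 * W23 * star W12 := by rw [u12, one_mul]
      _ = star W12 * (W12 * W13 * W23) * star W12 := by simp only [mul_assoc]
      _ = star W12 * W23 * (W12 * star W12) := by rw [← hpent]; simp only [mul_assoc]
      _ = star W12 * W23 := by rw [u12', mul_one]
  have p2 : star W23 * W12 * W13 = W12 * star W23 := by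
    calc star W23 * W12 * W13 = star W23 * W12 * W13 * (W23 * star W23) := by rw [u23', mul_one]
      _ = star W23 * (W12 * W13 * W23) * star W23 := by simp only [mul_assoc]
      _ = (star W23 * W23) * W12 * star W23 := by rw [← hpent]; simp only [mul_assoc]
      _ = W12 * star W23 := by rw [u23, one_mul]
  have hflip : ∀ a b x, ⟪t2.tmul a b, Sg x⟫_ℂ = ⟪t2.tmul b a, x⟫_ℂ := by
    intro a b x
    have : (innerSL ℂ (t2.tmul a b)).comp Sg = innerSL ℂ (t2.tmul b a) :=
      TP_ext t2 fun a' b' => by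
        simp [hSg, t2.inner_tmul]; ring
    exact DFunLike.congr_fun this x
  have hset : slicesR t2 t2 (Sg * W) = sl0 t2 W := by
    ext T
    simp only [slicesR, sl0, Set.mem_ofPred_eq, mul_apply_eq_comp, hflip]
  obtain ⟨V, hVd⟩ : ∃ V, V = (Submodule.span ℂ (sl0 t2 W)).topologicalClosure := ⟨_, rfl⟩
  have hVc : IsClosed (V : Set (H →L[ℂ] H)) := hVd ▸ Submodule.isClosed_topologicalClosure _
  have hC : hatA t2 (Sg * W) = (V : Set (H →L[ℂ] H)) := by
    rw [hatA, cspan, hset, hVd, Submodule.topologicalClosure_coe]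
  rw [hC] at hsemi ⊢
  have hsemi' : ∀ T : H →L[ℂ] H, IsCompactOperator T → T ∈ V := fun T hT => hsemi hT
  have q1 := part1 t2 t3 W W12 W23 W13 hW12 hW23 p1 L hL J2 J3 hJ2' hJ3'
    (leg13_J t2 t3 J2 hJ2' _ _ hW13.star') V hVd hsemi'
  have q2 := part2 t2 t3 W W12 W23 W13 hW12 hW23 hW13 p2 L hL J1 J2 hJ1' hJ2' V hVd hsemi'
  obtain ⟨st, hst, hstc⟩ : ∃ st : (H →L[ℂ] H) →ₛₗ[starRingEnd ℂ] (H →L[ℂ] H),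
      (∀ x, st x = star x) ∧ Continuous st :=
    ⟨{ toFun := star
       map_add' := star_add
       map_smul' := star_smul }, fun _ => rfl, continuous_star⟩
  have r1 : ∀ a ∈ V, ∀ b ∈ V, a * star b ∈ V := by
    intro a ha b hb
    have hb1 : ∀ a ∈ sl0 t2 W, a * star b ∈ V := by
      intro a ha
      have := map_mem_of_span (sl0 t2 W) V hVc ((LinearMap.mulLeft ℂ a).comp st)
        ((continuous_const.mul continuous_id).comp hstc)
        (fun b hb => by simpa [hst] using q1 a b ha hb) b (hVd ▸ hb)
      simpa [hst] using this
    exact map_mem_of_span (sl0 t2 W) V hVc (LinearMap.mulRight ℂ (star b))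
      (continuous_id.mul continuous_const) hb1 a (hVd ▸ ha)
  have r2 : ∀ a ∈ V, ∀ b ∈ V, star a * b ∈ V := by
    intro a ha b hb
    have hb1 : ∀ b ∈ sl0 t2 W, star a * b ∈ V := by
      intro b hb
      have := map_mem_of_span (sl0 t2 W) V hVc ((LinearMap.mulRight ℂ b).comp st)
        ((continuous_id.mul continuous_const).comp hstc)
        (fun a ha => by simpa [hst] using q2 a b ha hb) a (hVd ▸ ha)
      simpa [hst] using this
    exact map_mem_of_span (sl0 t2 W) V hVc (LinearMap.mulLeft ℂ (star a))
      (continuous_const.mul continuous_id) hb1 b (hVd ▸ hb)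
  have r3 := star_mem_of_mul_star V hVc r1 r2
  refine ⟨?_, ?_, ?_⟩
  · refine closure_minimal ?_ hVc
    refine Submodule.span_le.2 ?_
    rintro x ⟨a, ha, b, hb, rfl⟩
    exact r1 a ha b hb
  · refine closure_minimal ?_ hVc
    refine Submodule.span_le.2 ?_
    rintro x ⟨a, ha, b, hb, rfl⟩
    exact r2 a ha b hb
  · ext x
    constructor
    · rintro ⟨y, hy, rfl⟩
      exact r3 y hy
    · intro hx
      exact ⟨star x, r3 x hx, star_star x⟩

end
end

section
/- Let W be a multiplicative unitary on a complex Hilbert space H such that C(W) is self-adjoint, C(W)* = C(W) (this holds in particular if W is semi-regular). Then Â(W) is self-adjoint, Â(W)* = Â(W); since Â(W) is also a norm-closed subalgebra of B(H), it is a C*-subalgebra of B(H). -/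
/-!
Common framework: we axiomatize realizations of Hilbert-space tensor products.
A `TensorPair E F EF` realizes the Hilbert tensor product `E ⊗ F` as the Hilbert
space `EF`: it consists of a bilinear map `(a, b) ↦ a ⊗ b` whose image satisfies
the characteristic inner-product identity and has total (dense) linear span.
Operators such as the leg operators `X₁₂`, `X₂₃`, `X₁₃`, amplifications `a ⊗ b`,
and the tensor flip `Σ` are then uniquely characterized by their matrix
coefficients against elementary tensors.
-/

noncomputable section

open scoped InnerProductSpace
open ContinuousLinearMap

section HelperLemmas

variable {E F EF E' F' EF' G H H2 H3 : Type*}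
    [NormedAddCommGroup E] [InnerProductSpace ℂ E]
    [NormedAddCommGroup F] [InnerProductSpace ℂ F]
    [NormedAddCommGroup EF] [InnerProductSpace ℂ EF]
    [NormedAddCommGroup E'] [InnerProductSpace ℂ E']
    [NormedAddCommGroup F'] [InnerProductSpace ℂ F']
    [NormedAddCommGroup EF'] [InnerProductSpace ℂ EF']
    [NormedAddCommGroup G] [InnerProductSpace ℂ G]
    [NormedAddCommGroup H] [InnerProductSpace ℂ H]
    [NormedAddCommGroup H2] [InnerProductSpace ℂ H2]
    [NormedAddCommGroup H3] [InnerProductSpace ℂ H3]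

open scoped TensorProduct

/-- A map compatible with sums and scalars sends a closed span into a closed subspace. -/
theorem map_mem_of_closure {V U : Type*} [NormedAddCommGroup V] [NormedSpace ℂ V]
    [NormedAddCommGroup U] [NormedSpace ℂ U] (f : V → U) (g : ℂ → ℂ)
    (hc : Continuous f) (hadd : ∀ x y, f (x + y) = f x + f y)
    (hsmul : ∀ (c : ℂ) x, f (c • x) = g c • f x) (A : Submodule ℂ U)
    (hA : IsClosed (A : Set U)) (S : Set V) (hS : ∀ s ∈ S, f s ∈ A)
    (v : V) (hv : v ∈ closure (Submodule.span ℂ S : Set V)) : f v ∈ A := by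
  have h0 : f 0 = 0 := by
    have := hadd 0 0
    simpa using this
  have h1 : (Submodule.span ℂ S : Set V) ⊆ f ⁻¹' (A : Set U) := by
    intro x hx
    induction hx using Submodule.span_induction with
    | mem x h => exact hS x h
    | zero => simp [h0]
    | add x y _ _ hx hy =>
      show f (x + y) ∈ A
      rw [hadd]; exact A.add_mem hx hy
    | smul c x _ hx =>
      show f (c • x) ∈ A
      rw [hsmul]; exact A.smul_mem _ hx
  exact closure_minimal h1 (hA.preimage hc) hv

namespace TensorPair

theorem opExt (t : TensorPair E F EF) {A B : EF →L[ℂ] G}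
    (h : ∀ a b, A (t.tmul a b) = B (t.tmul a b)) : A = B :=
  ContinuousLinearMap.ext_on t.dense_span (by rintro _ ⟨a, b, rfl⟩; exact h a b)

theorem vecExt (t : TensorPair E F EF) {x y : EF}
    (h : ∀ a b, ⟪t.tmul a b, x⟫_ℂ = ⟪t.tmul a b, y⟫_ℂ) : x = y := by
  have : innerSL ℂ x = innerSL ℂ y := t.opExt (by
    intro a b
    have := congrArg (starRingEnd ℂ) (h a b)
    simpa only [inner_conj_symm, innerSL_apply_apply] using this)
  refine ext_inner_right ℂ fun v => ?_
  simpa using congrArg (fun L => L v) this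

theorem matExt (t : TensorPair E F EF) (t' : TensorPair E' F' EF') {A B : EF →L[ℂ] EF'}
    (h : ∀ a b a' b', ⟪t'.tmul a' b', A (t.tmul a b)⟫_ℂ = ⟪t'.tmul a' b', B (t.tmul a b)⟫_ℂ) :
    A = B :=
  t.opExt fun a b => t'.vecExt fun a' b' => h a b a' b'

theorem norm_lift_sq (f : E →ₗ[ℂ] F →ₗ[ℂ] G) (k : ℂ)
    (hf : ∀ a b a' b', ⟪f a b, f a' b'⟫_ℂ = k * (⟪a, a'⟫_ℂ * ⟪b, b'⟫_ℂ)) (z : E ⊗[ℂ] F) :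
    ‖TensorProduct.lift f z‖ ^ 2 = ‖k‖ * ‖z‖ ^ 2 := by
  have key : ∀ z w : E ⊗[ℂ] F,
      ⟪TensorProduct.lift f z, TensorProduct.lift f w⟫_ℂ = k * ⟪z, w⟫_ℂ := by
    intro z w
    induction z using TensorProduct.induction_on with
    | zero => simp
    | add x y hx hy => simp only [map_add, inner_add_left, hx, hy]; ring
    | tmul a b =>
      induction w using TensorProduct.induction_on with
      | zero => simp
      | add x y hx hy => simp only [map_add, inner_add_right, hx, hy]; ring
      | tmul a' b' => simp [hf]
  have h := congrArg norm (key z z)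
  have hz : ‖⟪z, z⟫_ℂ‖ = ‖z‖ ^ 2 := by
    have := inner_self_eq_norm_sq_to_K (𝕜 := ℂ) z
    exact (congrArg norm this).trans (by simp)
  rw [norm_mul, inner_self_eq_norm_sq_to_K, hz] at h
  simpa using h

theorem norm_lift_tmul (t : TensorPair E F EF) (z : E ⊗[ℂ] F) :
    ‖TensorProduct.lift t.tmul z‖ = ‖z‖ := by
  have := norm_lift_sq t.tmul 1 (by intro a b a' b'; rw [t.inner_tmul, one_mul]) z
  rw [norm_one, one_mul] at this
  exact (sq_eq_sq₀ (norm_nonneg _) (norm_nonneg _)).1 this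

theorem denseRange_lift (t : TensorPair E F EF) : DenseRange (TensorProduct.lift t.tmul) := by
  refine t.dense_span.mono ?_
  have : Submodule.span ℂ {z : EF | ∃ a b, z = t.tmul a b}
      ≤ LinearMap.range (TensorProduct.lift t.tmul) := by
    rw [Submodule.span_le]
    rintro _ ⟨a, b, rfl⟩
    exact ⟨a ⊗ₜ b, by simp⟩
  intro x hx
  exact this hx

/-- Universal property. -/
theorem exists_lift [CompleteSpace G] (t : TensorPair E F EF) (f : E →ₗ[ℂ] F →ₗ[ℂ] G) (C : ℝ)
    (hC : 0 ≤ C) (hf : ∀ z, ‖TensorProduct.lift f z‖ ≤ C * ‖z‖) :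
    ∃ L : EF →L[ℂ] G, (∀ a b, L (t.tmul a b) = f a b) ∧ ‖L‖ ≤ C := by
  have hb : ∀ z, ‖TensorProduct.lift f z‖ ≤ C * ‖TensorProduct.lift t.tmul z‖ := by
    intro z; rw [t.norm_lift_tmul]; exact hf z
  refine ⟨(TensorProduct.lift f).extendOfNorm (TensorProduct.lift t.tmul), ?_, ?_⟩
  · intro a b
    have := LinearMap.extendOfNorm_eq t.denseRange_lift ⟨C, hb⟩ (a ⊗ₜ b)
    simpa using this
  · exact LinearMap.opNorm_extendOfNorm_le t.denseRange_lift hC hb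

theorem exists_lift' [CompleteSpace G] (t : TensorPair E F EF) (f : E →ₗ[ℂ] F →ₗ[ℂ] G) (k : ℂ)
    (hf : ∀ a b a' b', ⟪f a b, f a' b'⟫_ℂ = k * (⟪a, a'⟫_ℂ * ⟪b, b'⟫_ℂ)) :
    ∃ L : EF →L[ℂ] G, ∀ a b, L (t.tmul a b) = f a b := by
  obtain ⟨L, hL, -⟩ := t.exists_lift f (Real.sqrt ‖k‖) (Real.sqrt_nonneg _) (by
    intro z
    refine le_of_eq ?_
    rw [← sq_eq_sq₀ (norm_nonneg _) (by positivity), norm_lift_sq f k hf, mul_pow,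
      Real.sq_sqrt (norm_nonneg _)])
  exact ⟨L, hL⟩

/-- `1 ⊗ c` as a bounded linear function of `c`. -/
theorem exists_amp [CompleteSpace EF] (t : TensorPair E F EF) :
    ∃ Φ : (F →L[ℂ] F) →L[ℂ] (EF →L[ℂ] EF), ∀ c a b, Φ c (t.tmul a b) = t.tmul a (c b) := by
  have h : ∀ c : F →L[ℂ] F, ∃ L : EF →L[ℂ] EF,
      (∀ a b, L (t.tmul a b) = t.tmul a (c b)) ∧ ‖L‖ ≤ ‖c‖ := by
    intro c
    have e : TensorProduct.lift (t.tmul.compl₂ c.toLinearMap)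
        = (TensorProduct.lift t.tmul) ∘ₗ (c.toLinearMap.lTensor E) := by
      ext a b; simp
    obtain ⟨L, hL, hn⟩ := t.exists_lift (t.tmul.compl₂ c.toLinearMap) ‖c‖ (norm_nonneg _) (by
      intro z
      rw [e, LinearMap.comp_apply, t.norm_lift_tmul, ← ContinuousLinearMap.lTensor_apply]
      exact (ContinuousLinearMap.le_opNorm _ _).trans
        (mul_le_mul_of_nonneg_right (ContinuousLinearMap.norm_lTensor_le _ _) (norm_nonneg _)))
    exact ⟨L, fun a b => by simp [hL], hn⟩
  choose Φ hΦ hn using h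
  refine ⟨LinearMap.mkContinuous
    { toFun := Φ
      map_add' := fun c d => t.opExt fun a b => by simp [hΦ]
      map_smul' := fun r c => t.opExt fun a b => by simp [hΦ] } 1 (fun c => by
        simpa using hn c), fun c a b => hΦ c a b⟩

theorem norm_tmul_s4 (t : TensorPair E F EF) (a : E) (b : F) : ‖t.tmul a b‖ = ‖a‖ * ‖b‖ := by
  have := t.norm_lift_tmul (a ⊗ₜ b)
  simpa using this

/-- `ins η : ζ ↦ ζ ⊗ η`. -/
def ins (t : TensorPair E F EF) : F →L[ℂ] E →L[ℂ] EF :=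
  t.tmul.flip.mkContinuous₂ 1 (fun x y => by
    rw [LinearMap.flip_apply, t.norm_tmul_s4, one_mul, mul_comm])

@[simp] theorem ins_apply (t : TensorPair E F EF) (η : F) (ζ : E) :
    t.ins η ζ = t.tmul ζ η := rfl

/-- The slice map. -/
def slc [CompleteSpace E] [CompleteSpace EF] (t : TensorPair E F EF) (X : EF →L[ℂ] EF)
    (ξ η : F) : E →L[ℂ] E :=
  adjoint (t.ins ξ) ∘L X ∘L t.ins η

section slc
variable [CompleteSpace E] [CompleteSpace EF] (t : TensorPair E F EF) (X : EF →L[ℂ] EF)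

theorem inner_slc (ξ η : F) (ζ ζ' : E) :
    ⟪ζ, t.slc X ξ η ζ'⟫_ℂ = ⟪t.tmul ζ ξ, X (t.tmul ζ' η)⟫_ℂ := by
  simp [slc, adjoint_inner_right]

theorem slc_unique {T : E →L[ℂ] E} {ξ η : F}
    (h : ∀ ζ ζ', ⟪ζ, T ζ'⟫_ℂ = ⟪t.tmul ζ ξ, X (t.tmul ζ' η)⟫_ℂ) : T = t.slc X ξ η := by
  ext ζ'
  refine ext_inner_left ℂ fun ζ => ?_
  rw [h, inner_slc]

theorem mem_slicesR_iff {T : E →L[ℂ] E} :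
    T ∈ slicesR t t X ↔ ∃ ξ η, T = t.slc X ξ η := by
  constructor
  · rintro ⟨ξ, η, h⟩
    exact ⟨ξ, η, t.slc_unique X h⟩
  · rintro ⟨ξ, η, rfl⟩
    exact ⟨ξ, η, t.inner_slc X ξ η⟩

theorem star_slc (ξ η : F) : star (t.slc X ξ η) = t.slc (star X) η ξ := by
  refine t.slc_unique _ fun ζ ζ' => ?_
  rw [star_eq_adjoint, star_eq_adjoint, adjoint_inner_right, adjoint_inner_right,
    ← inner_conj_symm, inner_slc, inner_conj_symm]

theorem slc_add_right (ξ η η' : F) : t.slc X ξ (η + η') = t.slc X ξ η + t.slc X ξ η' := by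
  simp [slc]

theorem slc_smul_right (ξ η : F) (c : ℂ) : t.slc X ξ (c • η) = c • t.slc X ξ η := by
  simp [slc]

theorem slc_add_left (ξ ξ' η : F) : t.slc X (ξ + ξ') η = t.slc X ξ η + t.slc X ξ' η := by
  simp [slc]

theorem slc_smul_left (ξ η : F) (c : ℂ) :
    t.slc X (c • ξ) η = (starRingEnd ℂ c) • t.slc X ξ η := by
  rw [slc, slc, map_smul, map_smulₛₗ, ContinuousLinearMap.smul_comp]

theorem continuous_slc_right (ξ : F) : Continuous (fun η => t.slc X ξ η) := by
  unfold slc; fun_prop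

theorem continuous_slc_left (η : F) : Continuous (fun ξ => t.slc X ξ η) := by
  have h : Continuous fun ξ => adjoint (t.ins ξ) :=
    (adjoint (𝕜 := ℂ) (E := E) (F := EF)).continuous.comp (t.ins).continuous
  unfold slc
  exact h.clm_comp continuous_const

end slc
end TensorPair

/-- `hatA` as a subspace. -/
def hatS (t : TensorPair H H H2) (X : H2 →L[ℂ] H2) : Submodule ℂ (H →L[ℂ] H) :=
  (Submodule.span ℂ (slicesR t t X)).topologicalClosure

theorem coe_hatS (t : TensorPair H H H2) (X : H2 →L[ℂ] H2) :
    (hatS t X : Set (H →L[ℂ] H)) = hatA t X := rfl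

theorem isClosed_hatS (t : TensorPair H H H2) (X : H2 →L[ℂ] H2) :
    IsClosed (hatS t X : Set (H →L[ℂ] H)) := Submodule.isClosed_topologicalClosure _

theorem slc_mem_hatS [CompleteSpace H] [CompleteSpace H2]
    (t : TensorPair H H H2) (X : H2 →L[ℂ] H2) (ξ η : H) : t.slc X ξ η ∈ hatS t X :=
  Submodule.le_topologicalClosure _ (Submodule.subset_span ((t.mem_slicesR_iff X).2 ⟨ξ, η, rfl⟩))

namespace TensorTriple

theorem opExt (t : TensorTriple H H H H3) {A B : H3 →L[ℂ] G}
    (h : ∀ a b c, A (t.tmul a b c) = B (t.tmul a b c)) : A = B :=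
  ContinuousLinearMap.ext_on t.dense_span (by rintro _ ⟨a, b, c, rfl⟩; exact h a b c)

theorem vecExt (t : TensorTriple H H H H3) {x y : H3}
    (h : ∀ a b c, ⟪t.tmul a b c, x⟫_ℂ = ⟪t.tmul a b c, y⟫_ℂ) : x = y := by
  have : innerSL ℂ x = innerSL ℂ y := t.opExt (by
    intro a b c
    have := congrArg (starRingEnd ℂ) (h a b c)
    simpa only [inner_conj_symm, innerSL_apply_apply] using this)
  refine ext_inner_right ℂ fun v => ?_
  simpa using congrArg (fun L => L v) this

variable [CompleteSpace H3]
  (t2 : TensorPair H H H2) (t3 : TensorTriple H H H H3)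

theorem exists_J : ∃ J : H → H2 →L[ℂ] H3, ∀ c a b, J c (t2.tmul a b) = t3.tmul a b c := by
  have : ∀ c, ∃ L : H2 →L[ℂ] H3, ∀ a b, L (t2.tmul a b) = t3.tmul a b c := by
    intro c
    obtain ⟨L, hL⟩ := t2.exists_lift' (LinearMap.mk₂ ℂ (fun a b => t3.tmul a b c)
      (by simp) (by simp) (by simp) (by simp)) ⟪c, c⟫_ℂ (by
        intro a b a' b'; simp only [LinearMap.mk₂_apply, t3.inner_tmul]; ring)
    exact ⟨L, fun a b => by simp [hL]⟩
  choose J hJ using this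
  exact ⟨J, hJ⟩

theorem exists_K : ∃ J : H → H2 →L[ℂ] H3, ∀ c a b, J c (t2.tmul a b) = t3.tmul c a b := by
  have : ∀ c, ∃ L : H2 →L[ℂ] H3, ∀ a b, L (t2.tmul a b) = t3.tmul c a b := by
    intro c
    obtain ⟨L, hL⟩ := t2.exists_lift' (LinearMap.mk₂ ℂ (fun a b => t3.tmul c a b)
      (by simp) (by simp) (by simp) (by simp)) ⟪c, c⟫_ℂ (by
        intro a b a' b'; simp only [LinearMap.mk₂_apply, t3.inner_tmul]; ring)
    exact ⟨L, fun a b => by simp [hL]⟩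
  choose J hJ using this
  exact ⟨J, hJ⟩

theorem exists_L : ∃ J : H → H2 →L[ℂ] H3, ∀ c a b, J c (t2.tmul a b) = t3.tmul a c b := by
  have : ∀ c, ∃ L : H2 →L[ℂ] H3, ∀ a b, L (t2.tmul a b) = t3.tmul a c b := by
    intro c
    obtain ⟨L, hL⟩ := t2.exists_lift' (LinearMap.mk₂ ℂ (fun a b => t3.tmul a c b)
      (by simp) (by simp) (by simp) (by simp)) ⟪c, c⟫_ℂ (by
        intro a b a' b'; simp only [LinearMap.mk₂_apply, t3.inner_tmul]; ring)
    exact ⟨L, fun a b => by simp [hL]⟩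
  choose J hJ using this
  exact ⟨J, hJ⟩

end TensorTriple

/-- Computing adjoint products through matrix coefficients. -/
theorem TensorPair.adj_comp [CompleteSpace EF] [CompleteSpace G]
    (t : TensorPair E F EF) (t' : TensorPair E' F' EF')
    (A : EF →L[ℂ] G) (B : EF' →L[ℂ] G) (M : EF' →L[ℂ] EF)
    (h : ∀ a b a' b', ⟪A (t.tmul a b), B (t'.tmul a' b')⟫_ℂ = ⟪t.tmul a b, M (t'.tmul a' b')⟫_ℂ)
    (u : EF) (v : EF') : ⟪A u, B v⟫_ℂ = ⟪u, M v⟫_ℂ := by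
  have : adjoint A ∘L B = M := t'.matExt t fun a b a' b' => by
    rw [ContinuousLinearMap.comp_apply, adjoint_inner_right, h]
  rw [← this, ContinuousLinearMap.comp_apply, adjoint_inner_right]

/-- Intertwining relation from matrix coefficients. -/
theorem leg_comm [CompleteSpace H] [CompleteSpace H2] [CompleteSpace H3]
    (t2 : TensorPair H H H2) (J : H → H2 →L[ℂ] H3)
    (hext : ∀ x y : H3, (∀ c a b, ⟪J c (t2.tmul a b), x⟫_ℂ = ⟪J c (t2.tmul a b), y⟫_ℂ) → x = y)
    (hJ : ∀ c c' a b a' b', ⟪J c (t2.tmul a b), J c' (t2.tmul a' b')⟫_ℂ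
      = ⟪t2.tmul a b, t2.tmul a' b'⟫_ℂ * ⟪c, c'⟫_ℂ)
    (X : H2 →L[ℂ] H2) (Y : H3 →L[ℂ] H3)
    (hXY : ∀ c c' a b a' b', ⟪J c (t2.tmul a b), Y (J c' (t2.tmul a' b'))⟫_ℂ
      = ⟪t2.tmul a b, X (t2.tmul a' b')⟫_ℂ * ⟪c, c'⟫_ℂ) :
    (∀ c c' u v, ⟪J c u, J c' v⟫_ℂ = ⟪u, v⟫_ℂ * ⟪c, c'⟫_ℂ) ∧
    (∀ c v, Y (J c v) = J c (X v)) ∧ (∀ c v, star Y (J c v) = J c (star X v)) := by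
  have h1 : ∀ c c' u v, ⟪J c u, J c' v⟫_ℂ = ⟪u, v⟫_ℂ * ⟪c, c'⟫_ℂ := by
    intro c c' u v
    rw [t2.adj_comp t2 (J c) (J c') (⟪c, c'⟫_ℂ • 1) (by
      intro a b a' b'; rw [hJ]; simp [mul_comm]) u v]
    simp [mul_comm]
  refine ⟨h1, ?_, ?_⟩
  · intro c v
    have : Y ∘L J c = J c ∘L X := t2.opExt fun a' b' => hext _ _ fun c' a b => by
      simp only [ContinuousLinearMap.comp_apply]
      rw [hXY, h1]
    simpa using congrArg (fun L => L v) this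
  · intro c v
    have : star Y ∘L J c = J c ∘L star X := t2.opExt fun a' b' => hext _ _ fun c' a b => by
      simp only [ContinuousLinearMap.comp_apply]
      rw [h1, star_eq_adjoint, star_eq_adjoint, adjoint_inner_right, adjoint_inner_right,
        ← inner_conj_symm, hXY, map_mul, inner_conj_symm, inner_conj_symm]
    simpa using congrArg (fun L => L v) this

end HelperLemmas

set_option maxHeartbeats 2000000 in
/-- If `W` is a multiplicative unitary on `H` with `C(W)* = C(W)`
(e.g. `W` semi-regular), then `Â(W)* = Â(W)`; being also a norm-closed
subalgebra, `Â(W)` is a C*-subalgebra of `B(H)`. -/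
theorem statement4
    {H H2 H3 : Type*}
    [NormedAddCommGroup H] [InnerProductSpace ℂ H] [CompleteSpace H]
    [NormedAddCommGroup H2] [InnerProductSpace ℂ H2] [CompleteSpace H2]
    [NormedAddCommGroup H3] [InnerProductSpace ℂ H3] [CompleteSpace H3]
    -- realizations of the tensor products H ⊗ H and H ⊗ H ⊗ H
    (t2 : TensorPair H H H2) (t3 : TensorTriple H H H H3)
    -- W is a unitary on H ⊗ H
    (W : H2 →L[ℂ] H2) (hWu : star W * W = 1 ∧ W * star W = 1)
    -- the legs W₁₂, W₂₃, W₁₃ of W on H ⊗ H ⊗ H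
    (W12 W23 W13 : H3 →L[ℂ] H3)
    (hW12 : IsLeg12 t2 t3 W W12) (hW23 : IsLeg23 t2 t3 W W23)
    (hW13 : IsLeg13 t2 t3 W W13)
    -- the pentagon equation W₂₃W₁₂ = W₁₂W₁₃W₂₃
    (hpent : W23 * W12 = W12 * W13 * W23)
    -- the tensor flip Σ on H ⊗ H
    (Sg : H2 →L[ℂ] H2) (hSg : ∀ a b : H, Sg (t2.tmul a b) = t2.tmul b a)
    -- C(W) is self-adjoint
    (hsa : star '' hatA t2 (Sg * W) = hatA t2 (Sg * W)) :
    star '' hatA t2 W = hatA t2 W ∧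
    (∀ a ∈ hatA t2 W, ∀ b ∈ hatA t2 W, a * b ∈ hatA t2 W) ∧
    IsClosed (hatA t2 W) := by
  obtain ⟨J, hJ⟩ := TensorTriple.exists_J t2 t3
  obtain ⟨K, hK⟩ := TensorTriple.exists_K t2 t3
  obtain ⟨L, hL⟩ := TensorTriple.exists_L t2 t3
  obtain ⟨Φ, hΦ⟩ := t2.exists_amp
  -- intertwining relations
  obtain ⟨J1, J2, J3⟩ := leg_comm t2 J
    (fun x y h => t3.vecExt fun a b c => by simpa only [hJ] using h c a b)
    (fun c c' a b a' b' => by rw [hJ, hJ, t3.inner_tmul, t2.inner_tmul]) W W12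
    (fun c c' a b a' b' => by rw [hJ, hJ, hW12])
  obtain ⟨K1, K2, K3⟩ := leg_comm t2 K
    (fun x y h => t3.vecExt fun a b c => by simpa only [hK] using h a b c)
    (fun c c' a b a' b' => by rw [hK, hK, t3.inner_tmul, t2.inner_tmul]; ring) W W23
    (fun c c' a b a' b' => by rw [hK, hK, hW23])
  obtain ⟨L1, L2, L3⟩ := leg_comm t2 L
    (fun x y h => t3.vecExt fun a b c => by simpa only [hL] using h b a c)
    (fun c c' a b a' b' => by rw [hL, hL, t3.inner_tmul, t2.inner_tmul]; ring) W W13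
    (fun c c' a b a' b' => by rw [hL, hL, hW13])
  -- unitarity
  have hWl : ∀ v, star W (W v) = v := fun v => congrArg (fun T => T v) hWu.1
  have hWr : ∀ v, W (star W v) = v := fun v => congrArg (fun T => T v) hWu.2
  have h12l : star W12 * W12 = 1 := t3.opExt fun a b c => by
    rw [← hJ]; simp only [ContinuousLinearMap.mul_apply, J2, J3, hWl]; rfl
  have h12r : W12 * star W12 = 1 := t3.opExt fun a b c => by
    rw [← hJ]; simp only [ContinuousLinearMap.mul_apply, J2, J3, hWr]; rfl
  have h23r : W23 * star W23 = 1 := t3.opExt fun a b c => by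
    rw [← hK]; simp only [ContinuousLinearMap.mul_apply, K2, K3, hWr]; rfl
  have pentA : W12 * W13 = W23 * W12 * star W23 := by
    rw [hpent, mul_assoc, h23r, mul_one]
  have pentB : star W12 * W23 = W13 * W23 * star W12 := by
    calc star W12 * W23 = star W12 * (W23 * W12) * star W12 := by
          rw [mul_assoc, mul_assoc, h12r, mul_one]
      _ = (star W12 * W12) * (W13 * W23) * star W12 := by rw [hpent]; simp only [mul_assoc]
      _ = W13 * W23 * star W12 := by rw [h12l, one_mul]
  -- the flip
  have hSg1 : ∀ u v, ⟪Sg u, Sg v⟫_ℂ = ⟪u, v⟫_ℂ := fun u v => by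
    rw [t2.adj_comp t2 Sg Sg 1 (by
      intro a b a' b'
      simp only [hSg, t2.inner_tmul, ContinuousLinearMap.one_apply]; ring) u v]
    rfl
  have hΦstar : ∀ c, star (Φ c) = Φ (star c) := fun c => t2.matExt t2 fun a b a' b' => by
    rw [star_eq_adjoint, star_eq_adjoint, adjoint_inner_right, hΦ, hΦ, t2.inner_tmul,
      t2.inner_tmul, adjoint_inner_right]
  -- amplification identity
  have hamp : ∀ ξ η u v, ⟪L ξ u, W23 (J η v)⟫_ℂ = ⟪u, Φ (t2.slc (Sg * W) ξ η) v⟫_ℂ := by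
    intro ξ η u v
    refine t2.adj_comp t2 (L ξ) (W23 ∘L J η) (Φ (t2.slc (Sg * W) ξ η)) ?_ u v
    intro a c' a' b
    rw [ContinuousLinearMap.comp_apply, hL, hJ, hW23, hΦ, t2.inner_tmul, t2.inner_slc,
      ← hSg ξ c', ContinuousLinearMap.mul_apply, hSg1, mul_comm]
  have hJK : ∀ ξ ζ u v, ⟪J ξ u, K ζ v⟫_ℂ = ⟪u, t2.tmul ζ (adjoint (t2.ins ξ) v)⟫_ℂ := by
    intro ξ ζ u v
    have := t2.adj_comp t2 (J ξ) (K ζ)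
      ((t2.tmul ζ).mkContinuous ‖ζ‖ (fun y => (t2.norm_tmul_s4 ζ y).le) ∘L adjoint (t2.ins ξ)) ?_ u v
    · simpa using this
    · intro a b a' b'
      simp only [ContinuousLinearMap.comp_apply, LinearMap.mkContinuous_apply, hJ, hK,
        t3.inner_tmul, t2.inner_tmul, adjoint_inner_right, TensorPair.ins_apply]
      ring
  have hJL : ∀ ξ η u v, ⟪J ξ u, L η v⟫_ℂ = ⟪u, t2.tmul (adjoint (t2.ins ξ) v) η⟫_ℂ := by
    intro ξ η u v
    have := t2.adj_comp t2 (J ξ) (L η) (t2.ins η ∘L adjoint (t2.ins ξ)) ?_ u v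
    · simpa using this
    · intro a b a' b'
      simp only [ContinuousLinearMap.comp_apply, hJ, hL,
        t3.inner_tmul, t2.inner_tmul, adjoint_inner_right, TensorPair.ins_apply]
      ring
  -- key identity
  have hkey : ∀ ξ₂ η₂ ξ₃ η₃, t2.slc (W * Φ (t2.slc (Sg * W) ξ₂ η₃) * star W) ξ₃ η₂
      = t2.slc (star W) ξ₂ (t2.slc W ξ₃ η₃ η₂) := by
    intro ξ₂ η₂ ξ₃ η₃
    refine t2.slc_unique _ fun ζ ζ' => ?_
    have e1 : ⟪t3.tmul ζ ξ₂ ξ₃, (star W12 * W23) (t3.tmul ζ' η₂ η₃)⟫_ℂ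
        = ⟪t2.tmul ζ ξ₂, star W (t2.tmul ζ' (t2.slc W ξ₃ η₃ η₂))⟫_ℂ := by
      rw [ContinuousLinearMap.mul_apply, star_eq_adjoint, adjoint_inner_right, ← hJ, J2, ← hK, K2,
        hJK, star_eq_adjoint, adjoint_inner_right]
      rfl
    have e2 : ⟪t3.tmul ζ ξ₂ ξ₃, (W13 * W23 * star W12) (t3.tmul ζ' η₂ η₃)⟫_ℂ
        = ⟪star W (t2.tmul ζ ξ₃), Φ (t2.slc (Sg * W) ξ₂ η₃) (star W (t2.tmul ζ' η₂))⟫_ℂ := by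
      rw [← hamp, ← L3, ← J3, hL, hJ, star_eq_adjoint W13, adjoint_inner_left]
      rfl
    rw [t2.inner_slc, ← e1, pentB, e2, star_eq_adjoint, adjoint_inner_left]
    rfl
  -- density of the ranges
  have hdense : ∀ v, v ∈ closure
      (Submodule.span ℂ {x : H | ∃ ξ η ζ, x = t2.slc W ξ η ζ} : Set H) := by
    have : (Submodule.span ℂ {x : H | ∃ ξ η ζ, x = t2.slc W ξ η ζ}).topologicalClosure = ⊤ := by
      rw [Submodule.topologicalClosure_eq_top_iff, Submodule.eq_bot_iff]
      intro x hx
      rw [Submodule.mem_orthogonal'] at hx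
      have h0 : adjoint W (t2.tmul x x) = 0 := t2.vecExt fun a b => by
        rw [adjoint_inner_right, ← inner_conj_symm, ← t2.inner_slc,
          hx _ (Submodule.subset_span ⟨x, b, a, rfl⟩)]
        simp
      have h1 : t2.tmul x x = 0 := by
        rw [← hWr (t2.tmul x x), star_eq_adjoint, h0, map_zero]
      have h2 := t2.norm_tmul_s4 x x
      rw [h1, norm_zero] at h2
      exact norm_eq_zero.1 (mul_self_eq_zero.1 h2.symm)
    intro v
    have hv : v ∈ (Submodule.span ℂ
      {x : H | ∃ ξ η ζ, x = t2.slc W ξ η ζ}).topologicalClosure := this ▸ Submodule.mem_top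
    exact hv
  -- slices of `W` are limits of slices of `star W`
  have hD : ∀ c ∈ hatA t2 (Sg * W), ∀ ξ η, t2.slc (W * Φ c * star W) ξ η ∈ hatS t2 (star W) := by
    intro c hc ξ η
    refine map_mem_of_closure (fun c => t2.slc (W * Φ c * star W) ξ η) id ?_ ?_ ?_ _
      (isClosed_hatS _ _) (slicesR t2 t2 (Sg * W)) ?_ c hc
    · unfold TensorPair.slc
      have : Continuous fun c => W * Φ c * star W := by fun_prop
      exact continuous_const.clm_comp (this.clm_comp continuous_const)
    · intro x y
      simp [TensorPair.slc, mul_add, add_mul]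
    · intro r x
      simp [TensorPair.slc]
    · intro s hs
      obtain ⟨ξ₂, η₃, rfl⟩ := (t2.mem_slicesR_iff _).1 hs
      simp only [hkey]
      exact slc_mem_hatS _ _ _ _
  have hmem : ∀ ξ η, t2.slc W η ξ ∈ hatS t2 (star W) := by
    intro ξ η
    refine map_mem_of_closure (fun η => t2.slc W η ξ) (starRingEnd ℂ)
      (t2.continuous_slc_left W ξ) (fun x y => t2.slc_add_left W x y ξ)
      (fun c x => t2.slc_smul_left W x ξ c) _ (isClosed_hatS _ _) _ ?_ η (hdense η)
    rintro _ ⟨ξ₃, η₃, η₂, rfl⟩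
    have e : t2.slc W (t2.slc W ξ₃ η₃ η₂) ξ
        = t2.slc (W * Φ (star (t2.slc (Sg * W) ξ η₃)) * star W) η₂ ξ₃ := by
      have := congrArg star (hkey ξ η₂ ξ₃ η₃)
      rw [t2.star_slc, t2.star_slc, star_star] at this
      rw [← this, star_mul, star_mul, star_star, hΦstar, mul_assoc]
    show t2.slc W (t2.slc W ξ₃ η₃ η₂) ξ ∈ hatS t2 (star W)
    rw [e]
    refine hD _ ?_ _ _
    rw [← hsa]
    exact ⟨_, slc_mem_hatS t2 (Sg * W) ξ η₃, rfl⟩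
  have hsub : ∀ T ∈ hatS t2 W, T ∈ hatS t2 (star W) := by
    intro T hT
    refine map_mem_of_closure (fun T => T) id continuous_id (fun _ _ => rfl) (fun _ _ => rfl)
      _ (isClosed_hatS _ _) (slicesR t2 t2 W) ?_ T hT
    intro s hs
    obtain ⟨ξ, η, rfl⟩ := (t2.mem_slicesR_iff _).1 hs
    exact hmem η ξ
  have hst : ∀ T ∈ hatS t2 (star W), star T ∈ hatS t2 W := by
    intro T hT
    refine map_mem_of_closure (fun T => star T) star continuous_star (fun _ _ => star_add _ _)
      (fun _ _ => star_smul _ _) _ (isClosed_hatS _ _) (slicesR t2 t2 (star W)) ?_ T hT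
    intro s hs
    obtain ⟨ξ, η, rfl⟩ := (t2.mem_slicesR_iff _).1 hs
    simp only [t2.star_slc, star_star]
    exact slc_mem_hatS _ _ _ _
  -- `H3` as the tensor product of `H` and `H2`
  let P : TensorPair H H2 H3 :=
    { tmul := LinearMap.mk₂ ℂ (fun ζ u => K ζ u)
        (fun x y u => by
          have : K (x + y) = K x + K y := t2.opExt fun a b => by simp [hK]
          simp [this])
        (fun r x u => by
          have : K (r • x) = r • K x := t2.opExt fun a b => by simp [hK]
          simp [this])
        (fun x u v => by simp) (fun r x u => by simp)
      inner_tmul := fun a c b d => by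
        simp only [LinearMap.mk₂_apply]; rw [K1, mul_comm]
      dense_span := by
        refine t3.dense_span.mono (Submodule.span_mono ?_)
        rintro _ ⟨a, b, c, rfl⟩
        exact ⟨a, t2.tmul b c, by simp [hK]⟩ }
  have hP : ∀ ζ u, P.tmul ζ u = K ζ u := fun _ _ => rfl
  have hPel : ∀ p q r s, P.slc W12 (t2.tmul p q) (t2.tmul r s) ∈ hatS t2 W := by
    intro p q r s
    have : P.slc W12 (t2.tmul p q) (t2.tmul r s) = ⟪q, s⟫_ℂ • t2.slc W p r := by
      refine (P.slc_unique _ fun ζ ζ' => ?_).symm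
      rw [ContinuousLinearMap.smul_apply, inner_smul_right, t2.inner_slc, hP, hP, hK, hK, hW12,
        mul_comm]
    rw [this]
    exact Submodule.smul_mem _ _ (slc_mem_hatS _ _ _ _)
  have hPall : ∀ u v, P.slc W12 u v ∈ hatS t2 W := by
    intro u v
    refine map_mem_of_closure (fun u => P.slc W12 u v) (starRingEnd ℂ)
      (P.continuous_slc_left W12 v) (fun x y => P.slc_add_left W12 x y v)
      (fun c x => P.slc_smul_left W12 x v c) _ (isClosed_hatS _ _) _ ?_ u (t2.dense_span u)
    rintro _ ⟨p, q, rfl⟩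
    refine map_mem_of_closure (fun v => P.slc W12 (t2.tmul p q) v) id
      (P.continuous_slc_right W12 _) (fun x y => P.slc_add_right W12 _ x y)
      (fun c x => P.slc_smul_right W12 _ x c) _ (isClosed_hatS _ _) _ ?_ v (t2.dense_span v)
    rintro _ ⟨r, s, rfl⟩
    exact hPel p q r s
  have hmul : ∀ ξ η ξ' η', t2.slc W ξ η * t2.slc W ξ' η' ∈ hatS t2 W := by
    intro ξ η ξ' η'
    have : t2.slc W ξ η * t2.slc W ξ' η'
        = P.slc W12 (star W (t2.tmul ξ ξ')) (star W (t2.tmul η η')) := by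
      refine P.slc_unique _ fun ζ ζ' => ?_
      have e1 : ⟪t3.tmul ζ ξ ξ', (W12 * W13) (t3.tmul ζ' η η')⟫_ℂ
          = ⟪ζ, (t2.slc W ξ η * t2.slc W ξ' η') ζ'⟫_ℂ := by
        rw [ContinuousLinearMap.mul_apply, ContinuousLinearMap.mul_apply, t2.inner_slc, ← hL η ζ' η', L2,
          ← adjoint_inner_left, ← star_eq_adjoint, ← hJ ξ' ζ ξ, J3, hJL, star_eq_adjoint,
          adjoint_inner_left]
        rfl
      rw [← e1, pentA, hP, hP, ← K3, ← K3, hK, hK, star_eq_adjoint W23, adjoint_inner_left]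
      rfl
    rw [this]
    exact hPall _ _
  refine ⟨?_, ?_, isClosed_hatS t2 W⟩
  · apply Set.Subset.antisymm
    · rintro _ ⟨T, hT, rfl⟩
      exact hst T (hsub T hT)
    · intro T hT
      exact ⟨star T, hst T (hsub T hT), star_star T⟩
  · intro a ha b hb
    refine map_mem_of_closure (fun a => a * b) id (continuous_id.mul continuous_const)
      (fun x y => add_mul x y b) (fun c x => smul_mul_assoc c x b) (hatS t2 W)
      (isClosed_hatS _ _) (slicesR t2 t2 W) ?_ a ha
    intro s hs
    obtain ⟨ξ, η, rfl⟩ := (t2.mem_slicesR_iff _).1 hs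
    refine map_mem_of_closure (fun b => t2.slc W ξ η * b) id (continuous_const.mul continuous_id)
      (fun x y => mul_add _ x y) (fun c x => mul_smul_comm c _ x) (hatS t2 W)
      (isClosed_hatS _ _) (slicesR t2 t2 W) ?_ b hb
    intro s hs
    obtain ⟨ξ', η', rfl⟩ := (t2.mem_slicesR_iff _).1 hs
    exact hmul ξ η ξ' η'

end
end
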